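/- arXiv:1405.6587 — 10 statements merged into one kernel-verified Lean document; each statement's English description precedes it below -/
import Mathlib

section
/- There exists a positive constant c such that for all sufficiently large integers r, G(r) > 2^{c (log r)^{5/2} / \sqrt{log log r}}; equivalently, for every sufficiently large r there exists an alternating-free edge coloring with r colors of the grid graph Γ_{n,n} with n = ⌊2^{c (log r)^{5/2} / \sqrt{log log r}}⌋. -/
/-- An edge coloring of the grid graph `Γ_{m,n}` (on vertex set `Fin m × Fin n`),
given as a function on unordered pairs of vertices, has an *alternating rectangle*
if there are `i < i'` and `j < j'` such that the two column edges
`{(i,j),(i',j)}`, `{(i,j'),(i',j')}` get the same color and the two row edges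
`{(i,j),(i,j')}`, `{(i',j),(i',j')}` get the same color. -/
def HasAltRect {m n : ℕ} {α : Type*} (c : Sym2 (Fin m × Fin n) → α) : Prop :=
  ∃ i i' : Fin m, ∃ j j' : Fin n, i < i' ∧ j < j' ∧
    c s((i, j), (i', j)) = c s((i, j'), (i', j')) ∧
    c s((i, j), (i, j')) = c s((i', j), (i', j'))

theorem eventually_logb_bounds : ∀ᶠ r : ℕ in Filter.atTop,
    16 ≤ Real.logb 2 r ∧ 16 * Real.logb 2 (Real.logb 2 r) ≤ Real.logb 2 r := by
  have hL : Filter.Tendsto (fun r : ℕ => Real.logb 2 r) Filter.atTop Filter.atTop :=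
    (Real.tendsto_logb_atTop one_lt_two).comp tendsto_natCast_atTop_atTop
  have hlog : ∀ᶠ x : ℝ in Filter.atTop, 16 * Real.logb 2 x ≤ x := by
    have h2 : (0 : ℝ) < Real.log 2 := Real.log_pos one_lt_two
    filter_upwards [Real.isLittleO_log_id_atTop.bound (show 0 < Real.log 2 / 16 by positivity),
      Filter.eventually_ge_atTop 1] with x hx hx1
    rw [Real.norm_eq_abs, abs_of_nonneg (Real.log_nonneg hx1), id, Real.norm_eq_abs,
      abs_of_nonneg (by linarith)] at hx
    rw [Real.logb]
    field_simp
    linarith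
  exact (hL.eventually_ge_atTop 16).and (hL.eventually hlog)

/-- The columns of the grid: `t` blocks of `a` coordinates with values in `Fin K`. -/
abbrev GridPoint (t a K : ℕ) := Fin t → Fin a → Fin K

/-- A color consists of a block, a coordinate of that block, a value, and a set of coordinates
of the block. -/
abbrev DiffColor (t a K : ℕ) := Fin t × Fin a × Fin K × Finset (Fin a)

/-- The color `(l, i, α, D)` describes the ordered pair `(x, y)` if, in block `l`, the points `x`
and `y` differ exactly on `D`, the first element of `D` is `i`, and `x` takes the value `α`
there. -/
def Describes {t a K : ℕ} (e : DiffColor t a K) (x y : GridPoint t a K) : Prop :=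
  (∀ j, j ∈ e.2.2.2 ↔ x e.1 j ≠ y e.1 j) ∧ e.2.1 ∈ e.2.2.2 ∧
    (∀ j ∈ e.2.2.2, e.2.1 ≤ j) ∧ x e.1 e.2.1 = e.2.2.1

theorem exists_describes {t a K : ℕ} {x y : GridPoint t a K} (h : x ≠ y) :
    ∃ e, Describes e x y := by
  obtain ⟨l, hl⟩ := Function.ne_iff.1 h
  obtain ⟨j, hj⟩ := Function.ne_iff.1 hl
  have hne : (Finset.univ.filter fun j => x l j ≠ y l j).Nonempty := ⟨j, by simpa using hj⟩
  refine ⟨(l, Finset.min' _ hne, x l (Finset.min' _ hne),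
    Finset.univ.filter fun j => x l j ≠ y l j), ?_, Finset.min'_mem _ hne, ?_, rfl⟩
  · simp
  · intro j hj
    exact Finset.min'_le _ _ hj

/-- The colors of `X` in the block of `e` whose difference set contains the leading coordinate
of `e`. -/
def hitting {t a K : ℕ} (X : Finset (DiffColor t a K)) (e : DiffColor t a K) :
    Finset (DiffColor t a K) :=
  X.filter fun b => b.1 = e.1 ∧ e.2.1 ∈ b.2.2.2

/-- If no coordinate is hit by `d` colors, the colors split into `d` classes within which no
color meets the leading coordinate of another color of the same block. -/
theorem exists_class_map {t a K d : ℕ} (hd : 0 < d) (X : Finset (DiffColor t a K))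
    (hX : ∀ e ∈ X, e.2.1 ∈ e.2.2.2 ∧ ∀ j ∈ e.2.2.2, e.2.1 ≤ j)
    (hlight : ∀ e ∈ X, (hitting X e).card < d) :
    ∃ g : DiffColor t a K → Fin d, ∀ e ∈ X, ∀ e' ∈ X, e' ≠ e → e'.1 = e.1 → g e' = g e →
      e'.2.1 ∉ e.2.2.2 := by
  induction X using Finset.induction_on_max_value (fun e : DiffColor t a K => e.2.1) with
  | empty => exact ⟨fun _ => ⟨0, hd⟩, by simp⟩
  | insert b s hb hmax ih =>
    obtain ⟨g, hg⟩ := ih (fun e he => hX e (Finset.mem_insert_of_mem he)) (fun e he =>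
      lt_of_le_of_lt (Finset.card_le_card (Finset.filter_subset_filter _
        (Finset.subset_insert _ _))) (hlight e (Finset.mem_insert_of_mem he)))
    have hbX := hX b (Finset.mem_insert_self _ _)
    have hcard : ((hitting s b).image g).card < Fintype.card (Fin d) := by
      rw [Fintype.card_fin]
      refine lt_of_le_of_lt Finset.card_image_le ?_
      exact lt_of_le_of_lt (Finset.card_le_card (Finset.filter_subset_filter _
        (Finset.subset_insert _ _))) (hlight b (Finset.mem_insert_self _ _))
    obtain ⟨z, hz⟩ : ∃ z, z ∉ (hitting s b).image g := by
      by_contra! h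
      exact absurd hcard (by rw [Finset.eq_univ_iff_forall.2 h, Finset.card_univ]; exact lt_irrefl _)
    have hz' : ∀ e ∈ s, e.1 = b.1 → b.2.1 ∈ e.2.2.2 → g e ≠ z := by
      intro e he h1 h2 h3
      exact hz (Finset.mem_image.2 ⟨e, Finset.mem_filter.2 ⟨he, h1, h2⟩, h3⟩)
    refine ⟨Function.update g b z, ?_⟩
    intro e he e' he' hne hl hc hmem
    rcases Finset.mem_insert.1 he with rfl | hes
    · have hes' : e' ∈ s := (Finset.mem_insert.1 he').resolve_left hne
      rw [Function.update_self, Function.update_of_ne hne] at hc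
      have heq : e'.2.1 = e.2.1 := le_antisymm (hmax e' hes') (hbX.2 _ hmem)
      exact hz' e' hes' hl (heq ▸ (hX e' he').1) hc
    · have hebne : e ≠ b := fun h => hb (h ▸ hes)
      rcases Finset.mem_insert.1 he' with rfl | hes'
      · rw [Function.update_self, Function.update_of_ne hebne] at hc
        exact hz' e hes hl.symm hmem hc.symm
      · have hebne' : e' ≠ b := fun h => hb (h ▸ hes')
        rw [Function.update_of_ne hebne, Function.update_of_ne hebne'] at hc
        exact hg e hes e' hes' hne hl hc hmem

theorem exists_coloring_of_light {t a K d : ℕ} (hd : 0 < d) (X : Finset (DiffColor t a K))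
    (hX : ∀ e ∈ X, e.2.1 ∈ e.2.2.2 ∧ ∀ j ∈ e.2.2.2, e.2.1 ≤ j)
    (hlight : ∀ e ∈ X, (hitting X e).card < d) :
    ∃ f : GridPoint t a K → ℕ, (∀ x, f x < 2 ^ (t * d)) ∧
      ∀ x y, ∀ e ∈ X, Describes e x y → f x ≠ f y := by
  obtain ⟨g, hg⟩ := exists_class_map hd X hX hlight
  let φ : GridPoint t a K → Fin t × Fin d → ZMod 2 := fun x q =>
    ∑ e ∈ X with e.1 = q.1 ∧ g e = q.2, if x e.1 e.2.1 = e.2.2.1 then 1 else 0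
  have hcard : Fintype.card (Fin t × Fin d → ZMod 2) = 2 ^ (t * d) := by
    simp [ZMod.card]
  let E := Fintype.equivFinOfCardEq hcard
  refine ⟨fun x => E (φ x), fun x => (E (φ x)).2, ?_⟩
  intro x y e he hxy hf
  have hφ : φ x = φ y := E.injective (Fin.ext hf)
  have h := congrFun hφ (e.1, g e)
  have hmem : e ∈ X.filter fun e' => e'.1 = e.1 ∧ g e' = g e := by simp [he]
  obtain ⟨h1, h2, h3, h4⟩ := hxy
  have hy : y e.1 e.2.1 ≠ e.2.2.1 := by
    rw [← h4]
    exact ((h1 _).1 h2).symm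
  simp only [φ] at h
  rw [← Finset.add_sum_erase _ _ hmem, ← Finset.add_sum_erase _ _ hmem, if_pos h4, if_neg hy,
    zero_add] at h
  have hrest : ∀ e' ∈ (X.filter fun e' => e'.1 = e.1 ∧ g e' = g e).erase e,
      (if x e'.1 e'.2.1 = e'.2.2.1 then (1 : ZMod 2) else 0) =
        if y e'.1 e'.2.1 = e'.2.2.1 then 1 else 0 := by
    intro e' he'
    obtain ⟨hne, he'⟩ := Finset.mem_erase.1 he'
    obtain ⟨he'X, hl, hc⟩ := Finset.mem_filter.1 he'
    have hnot := hg e he e' he'X hne hl hc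
    have : x e'.1 e'.2.1 = y e'.1 e'.2.1 := by
      rw [hl]
      by_contra hcon
      exact hnot ((h1 _).2 hcon)
    rw [this]
  rw [Finset.sum_congr rfl hrest] at h
  simp at h

/-- The union of few color classes has small chromatic number. -/
theorem exists_coloring {t a K d : ℕ} (hd : 0 < d) (k : ℕ) (X : Finset (DiffColor t a K))
    (hX : ∀ e ∈ X, e.2.1 ∈ e.2.2.2 ∧ ∀ j ∈ e.2.2.2, e.2.1 ≤ j)
    (hk : X.card < (k + 1) * d) :
    ∃ f : GridPoint t a K → ℕ, (∀ x, f x < 2 ^ (t * d) * (X.card + 1) ^ k) ∧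
      ∀ x y, ∀ e ∈ X, Describes e x y → f x ≠ f y := by
  induction hn : X.card using Nat.strong_induction_on generalizing X k with
  | _ n ih =>
  subst hn
  by_cases hlight : ∀ e ∈ X, (hitting X e).card < d
  · obtain ⟨f, hf, hf'⟩ := exists_coloring_of_light hd X hX hlight
    refine ⟨f, fun x => (hf x).trans_le ?_, hf'⟩
    exact Nat.le_mul_of_pos_right _ (by positivity)
  push Not at hlight
  obtain ⟨b, hb, hheavy⟩ := hlight
  have hsub : hitting X b ⊆ X := Finset.filter_subset _ _
  have hXd : d ≤ X.card := hheavy.trans (Finset.card_le_card hsub)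
  obtain ⟨k, rfl⟩ : ∃ k', k = k' + 1 := by
    refine Nat.exists_eq_succ_of_ne_zero ?_
    rintro rfl
    omega
  have hc1 : (X \ hitting X b).card ≤ X.card - d := by
    rw [Finset.card_sdiff_of_subset hsub]
    omega
  have hc2 : (X.erase b).card = X.card - 1 := Finset.card_erase_of_mem hb
  have hpos : 0 < X.card := by omega
  obtain ⟨f₁, hf₁, hf₁'⟩ := ih _ (by omega) k (X \ hitting X b)
    (fun e he => hX e (Finset.sdiff_subset he)) (by
      have : (k + 1 + 1) * d = (k + 1) * d + d := by ring
      omega) rfl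
  obtain ⟨f₂, hf₂, hf₂'⟩ := ih _ (by omega) (k + 1) (X.erase b)
    (fun e he => hX e (Finset.erase_subset _ _ he)) (by omega) rfl
  have hB₁ : ∀ x, f₁ x < 2 ^ (t * d) * X.card ^ k := fun x =>
    (hf₁ x).trans_le (Nat.mul_le_mul_left _ (Nat.pow_le_pow_left (by omega) _))
  have hB₂ : ∀ x, f₂ x < 2 ^ (t * d) * X.card ^ (k + 1) := fun x => by
    have := hf₂ x
    rwa [hc2, Nat.sub_add_cancel hpos] at this
  have hB : 2 ^ (t * d) * X.card ^ k + 2 ^ (t * d) * X.card ^ (k + 1) ≤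
      2 ^ (t * d) * (X.card + 1) ^ (k + 1) := by
    calc _ = 2 ^ (t * d) * (X.card ^ k * (X.card + 1)) := by ring
      _ ≤ 2 ^ (t * d) * ((X.card + 1) ^ k * (X.card + 1)) := by gcongr; omega
      _ = _ := by ring
  refine ⟨fun x => if x b.1 b.2.1 = b.2.2.1 then f₁ x else 2 ^ (t * d) * X.card ^ k + f₂ x,
    fun x => ?_, fun x y e he hxy => ?_⟩
  · have h1 := hB₁ x
    have h2 := hB₂ x
    dsimp only
    split_ifs <;> omega
  · have h1 := hB₁ x
    have h2 := hB₁ y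
    dsimp only
    split_ifs with hx hy hy
    · refine hf₁' x y e (Finset.mem_sdiff.2 ⟨he, fun hmem => ?_⟩) hxy
      obtain ⟨-, hl, hD⟩ := Finset.mem_filter.1 hmem
      refine (hxy.1 _).1 hD ?_
      rw [hl, hx, hy]
    · omega
    · omega
    · have := hf₂' x y e (Finset.mem_erase.2 ⟨?_, he⟩) hxy
      · omega
      · rintro rfl
        exact hx hxy.2.2.2

/-- A coloring of the rows and of the columns gives a coloring of the grid graph. -/
theorem exists_col_of_rows_cols {n r : ℕ} (R C : Fin n → Fin n → Fin n → Fin r)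
    (h : ∀ i i' j j', i < i' → j < j' → C i i' j = C i i' j' → R i j j' ≠ R i' j j') :
    ∃ col : Sym2 (Fin n × Fin n) → Fin r, ¬ HasAltRect col := by
  refine ⟨Sym2.lift ⟨fun p q => if p.1 = q.1 then R p.1 (min p.2 q.2) (max p.2 q.2)
    else C (min p.1 q.1) (max p.1 q.1) (min p.2 q.2), fun p q => ?_⟩, ?_⟩
  · dsimp only
    by_cases hpq : p.1 = q.1
    · rw [if_pos hpq, if_pos hpq.symm, hpq, min_comm, max_comm]
    · rw [if_neg hpq, if_neg (Ne.symm hpq), min_comm p.1, max_comm p.1, min_comm p.2]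
  · rintro ⟨i, i', j, j', hi, hj, h1, h2⟩
    simp only [Sym2.lift_mk, if_neg hi.ne, if_true, min_eq_left hi.le, max_eq_right hi.le,
      min_eq_left hj.le, max_eq_right hj.le, min_self] at h1 h2
    exact h i i' j j' hi hj h1 h2

/-- Reed–Solomon codes: many functions into a prime field with few pairwise agreements. -/
theorem exists_codewords {A : Type*} [Fintype A] {p m n : ℕ} [Fact p.Prime]
    (hA : Fintype.card A ≤ p) (hn : n ≤ p ^ m) :
    ∃ w : Fin n → A → ZMod p, ∀ i i', i ≠ i' →
      (Finset.univ.filter fun e => w i e = w i' e).card < m := by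
  classical
  have hA' : Fintype.card A ≤ Fintype.card (ZMod p) := by rwa [ZMod.card]
  obtain ⟨code⟩ := Function.Embedding.nonempty_of_card_le hA'
  have hn' : Fintype.card (Fin n) ≤ Fintype.card (Fin m → ZMod p) := by
    simpa [ZMod.card] using hn
  obtain ⟨coef⟩ := Function.Embedding.nonempty_of_card_le hn'
  let P : Fin n → Polynomial (ZMod p) := fun i =>
    ((Polynomial.degreeLTEquiv (ZMod p) m).symm (coef i) : Polynomial.degreeLT (ZMod p) m)
  have hPinj : Function.Injective P := fun i i' h =>
    coef.injective ((Polynomial.degreeLTEquiv (ZMod p) m).symm.injective (Subtype.ext h))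
  have hPdeg : ∀ i, (P i).degree < m := fun i => Polynomial.mem_degreeLT.1 (Subtype.property _)
  refine ⟨fun i e => (P i).eval (code e), fun i i' hii => ?_⟩
  have hne : P i - P i' ≠ 0 := sub_ne_zero.2 (hPinj.ne hii)
  have hdeg : (P i - P i').natDegree < m := by
    rw [Polynomial.natDegree_lt_iff_degree_lt hne]
    exact lt_of_le_of_lt (Polynomial.degree_sub_le _ _) (max_lt (hPdeg i) (hPdeg i'))
  refine lt_of_le_of_lt ?_ hdeg
  rw [← Finset.card_map code]
  refine Polynomial.card_le_degree_of_subset_roots fun z hz => ?_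
  obtain ⟨e, he, rfl⟩ := Finset.mem_map.1 hz
  rw [Polynomial.mem_roots hne]
  simpa [sub_eq_zero] using he

theorem exists_col_of_parameters {t a n r : ℕ} (ht : 0 < t) (ha : 0 < a)
    (hr : 2 * (t * (a * (2 ^ a * 2 ^ a))) ≤ r)
    (hr' : 2 ^ (t * (a / t + 1)) * (t * a) ^ (t ^ 2) ≤ r) (hn : n ≤ 2 ^ (t * a * a)) :
    ∃ col : Sym2 (Fin n × Fin n) → Fin r, ¬ HasAltRect col := by
  classical
  obtain ⟨p, hp, hNp, hpN⟩ := Nat.exists_prime_lt_and_le_two_mul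
    (t * (a * (2 ^ a * 2 ^ a))) (by positivity)
  have : Fact p.Prime := ⟨hp⟩
  have hcardA : Fintype.card (DiffColor t a (2 ^ a)) = t * (a * (2 ^ a * 2 ^ a)) := by
    simp
  have hta : 0 < t * a := by positivity
  have h2p : 2 ^ a ≤ p := by
    refine le_trans ?_ hNp.le
    calc 2 ^ a = 1 * (1 * (1 * 2 ^ a)) := by ring
      _ ≤ _ := by gcongr <;> first | omega | exact Nat.one_le_two_pow
  have hnp : n ≤ p ^ (t * a) := by
    refine hn.trans ?_
    rw [mul_comm (t * a) a, pow_mul]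
    exact Nat.pow_le_pow_left h2p _
  obtain ⟨w, hw⟩ := exists_codewords (A := DiffColor t a (2 ^ a)) (hcardA.trans_le hNp.le) hnp
  have hnV : Fintype.card (Fin n) ≤ Fintype.card (GridPoint t a (2 ^ a)) := by
    simp only [Fintype.card_fin, Fintype.card_pi, Finset.prod_const, Finset.card_univ, ← pow_mul]
    convert hn using 2
    ring
  obtain ⟨v⟩ := Function.Embedding.nonempty_of_card_le hnV
  have hdesc : ∀ j j' : Fin n, j ≠ j' → ∃ e, Describes e (v j) (v j') := fun j j' h =>
    exists_describes (v.injective.ne h)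
  have he₀ : Nonempty (DiffColor t a (2 ^ a)) :=
    ⟨(⟨0, ht⟩, ⟨0, ha⟩, ⟨0, by positivity⟩, ∅)⟩
  choose! c hc using hdesc
  have hχ : ∀ i i' : Fin n, i ≠ i' → ∃ f : GridPoint t a (2 ^ a) → ℕ, (∀ x, f x < r) ∧
      ∀ x y e, w i e = w i' e → Describes e x y → f x ≠ f y := by
    intro i i' hii
    let X := (Finset.univ.filter fun e => w i e = w i' e).filter
      fun e : DiffColor t a (2 ^ a) => e.2.1 ∈ e.2.2.2 ∧ ∀ j ∈ e.2.2.2, e.2.1 ≤ j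
    have hXcard : X.card < t * a := (Finset.card_filter_le _ _).trans_lt (hw i i' hii)
    have hd : t * a ≤ (t ^ 2 + 1) * (a / t + 1) := by
      have h1 : a ≤ t * (a / t + 1) := (Nat.lt_mul_div_succ a ht).le
      nlinarith
    obtain ⟨f, hf, hf'⟩ := exists_coloring (d := a / t + 1) (Nat.succ_pos _) (t ^ 2) X
      (fun e he => (Finset.mem_filter.1 he).2) (hXcard.trans_le hd)
    refine ⟨f, fun x => (hf x).trans_le (le_trans ?_ hr'), fun x y e he hxy => ?_⟩
    · gcongr
      exact hXcard
    · refine hf' x y e ?_ hxy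
      simp only [X, Finset.mem_filter, Finset.mem_univ, true_and]
      exact ⟨he, hxy.2.1, hxy.2.2.1⟩
  have hr0 : 0 < r := lt_of_lt_of_le (by positivity) hr
  choose! f hf hf' using hχ
  refine exists_col_of_rows_cols
    (fun i j j' => ⟨(w i (c j j')).val, (ZMod.val_lt _).trans_le (hpN.trans hr)⟩)
    (fun i i' j => ⟨f i i' (v j) % r, Nat.mod_lt _ hr0⟩) ?_
  intro i i' j j' hi hj h1 h2
  rw [Fin.mk.injEq] at h1 h2
  rw [Nat.mod_eq_of_lt (hf i i' hi.ne _), Nat.mod_eq_of_lt (hf i i' hi.ne _)] at h1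
  exact hf' i i' hi.ne _ _ _ (ZMod.val_injective p h2) (hc j j' hj.ne) h1

/-- There is a constant `c > 0` such that for all sufficiently large `r`, with
`n = ⌊2 ^ (c (log r)^{5/2} / √(log log r))⌋`, the grid graph `Γ_{n,n}` admits an
alternating-rectangle-free edge coloring with `r` colors (i.e. `G(r) > n`). -/
theorem grid_ramsey_superpolynomial_lower_bound :
    ∃ c : ℝ, 0 < c ∧ ∃ r0 : ℕ, ∀ r : ℕ, r0 ≤ r →
      ∃ col : Sym2 (Fin (⌊(2 : ℝ) ^ (c * (Real.logb 2 r) ^ ((5 : ℝ) / 2) /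
            Real.sqrt (Real.logb 2 (Real.logb 2 r)))⌋₊) ×
          Fin (⌊(2 : ℝ) ^ (c * (Real.logb 2 r) ^ ((5 : ℝ) / 2) /
            Real.sqrt (Real.logb 2 (Real.logb 2 r)))⌋₊)) → Fin r,
        ¬ HasAltRect col := by
  obtain ⟨r0, hr0⟩ := Filter.eventually_atTop.1 eventually_logb_bounds
  refine ⟨1 / 1024, by norm_num, r0, fun r hr => ?_⟩
  obtain ⟨hL, hℓL⟩ := hr0 r hr
  set L := Real.logb 2 r with hLdef
  set ℓ := Real.logb 2 L with hℓdef
  have hrpos : (0 : ℝ) < r := by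
    rcases Nat.eq_zero_or_pos r with h | h
    · rw [hLdef, h, Nat.cast_zero, Real.logb_zero] at hL
      linarith
    · exact_mod_cast h
  have hrL : (2 : ℝ) ^ L = r := Real.rpow_logb two_pos (by norm_num) hrpos
  have hLℓ : (2 : ℝ) ^ ℓ = L := Real.rpow_logb two_pos (by norm_num) (by linarith)
  have hℓ : 4 ≤ ℓ := by
    rw [hℓdef, Real.le_logb_iff_rpow_le one_lt_two (by linarith)]
    norm_num
    exact hL
  set q := Real.sqrt (L / ℓ) with hq
  have hqsq : q ^ 2 = L / ℓ := Real.sq_sqrt (by positivity)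
  have hq4 : 4 ≤ q := by
    apply Real.le_sqrt_of_sq_le
    rw [le_div_iff₀ (by linarith)]
    linarith
  obtain ⟨t, ht1, ht2⟩ : ∃ t : ℕ, (t : ℝ) ≤ q / 2 ∧ q / 4 ≤ t :=
    ⟨⌊q / 2⌋₊, Nat.floor_le (by positivity), by linarith [Nat.lt_floor_add_one (q / 2)]⟩
  obtain ⟨a, ha1, ha2⟩ : ∃ a : ℕ, (a : ℝ) ≤ L / 8 ∧ L / 16 ≤ a :=
    ⟨⌊L / 8⌋₊, Nat.floor_le (by positivity), by linarith [Nat.lt_floor_add_one (L / 8)]⟩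
  have ht : (0 : ℝ) < t := by linarith
  have ha : (0 : ℝ) < a := by linarith
  have hqℓ : q ^ 2 * ℓ = L := by rw [hqsq]; field_simp
  have htℓ : (t : ℝ) ^ 2 * ℓ ≤ L / 4 := by
    have : (t : ℝ) ^ 2 ≤ (q / 2) ^ 2 := by gcongr
    nlinarith
  have htL : (t : ℝ) ≤ L / 8 := by nlinarith
  have htaL : (t : ℝ) * a ≤ (2 : ℝ) ^ (2 * ℓ) := by
    rw [mul_comm 2 ℓ, Real.rpow_mul two_pos.le, hLℓ, Real.rpow_two]
    nlinarith
  refine exists_col_of_parameters (t := t) (a := a) (by exact_mod_cast ht) (by exact_mod_cast ha)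
    ?_ ?_ ?_
  · have h : (2 : ℝ) * (t * (a * (2 ^ a * 2 ^ a))) ≤ r := by
      calc (2 : ℝ) * (t * (a * (2 ^ a * 2 ^ a)))
          = (2 : ℝ) ^ (1 : ℝ) * (t * a) * ((2 : ℝ) ^ (a : ℝ) * (2 : ℝ) ^ (a : ℝ)) := by
            rw [Real.rpow_natCast, Real.rpow_one]; ring
        _ ≤ (2 : ℝ) ^ (1 : ℝ) * (2 : ℝ) ^ (2 * ℓ) * ((2 : ℝ) ^ (a : ℝ) * (2 : ℝ) ^ (a : ℝ)) := by
            gcongr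
        _ = (2 : ℝ) ^ (1 + 2 * ℓ + (a + a)) := by
            rw [Real.rpow_add two_pos, Real.rpow_add two_pos, Real.rpow_add two_pos]
        _ ≤ (2 : ℝ) ^ L := Real.rpow_le_rpow_of_exponent_le one_le_two (by linarith)
        _ = r := hrL
    exact_mod_cast h
  · have hd : ((t * (a / t + 1) : ℕ) : ℝ) ≤ a + t := by
      have : t * (a / t + 1) ≤ a + t := by
        rw [mul_add, mul_one]
        gcongr
        exact Nat.mul_div_le a t
      exact_mod_cast this
    have h : (2 : ℝ) ^ (t * (a / t + 1)) * ((t : ℝ) * a) ^ (t ^ 2) ≤ r := by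
      calc (2 : ℝ) ^ (t * (a / t + 1)) * ((t : ℝ) * a) ^ (t ^ 2)
          ≤ (2 : ℝ) ^ (t * (a / t + 1)) * ((2 : ℝ) ^ (2 * ℓ)) ^ (t ^ 2) := by gcongr
        _ = (2 : ℝ) ^ (((t * (a / t + 1) : ℕ) : ℝ) + 2 * ℓ * ((t ^ 2 : ℕ) : ℝ)) := by
            rw [Real.rpow_add two_pos, Real.rpow_natCast, Real.rpow_mul two_pos.le (2 * ℓ),
              Real.rpow_natCast]
        _ ≤ (2 : ℝ) ^ L := by
            refine Real.rpow_le_rpow_of_exponent_le one_le_two ?_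
            push_cast at hd ⊢
            nlinarith
        _ = r := hrL
    exact_mod_cast h
  · refine Nat.floor_le_of_le ?_
    push_cast
    rw [← Real.rpow_natCast]
    refine Real.rpow_le_rpow_of_exponent_le one_le_two ?_
    have hLpow : L ^ ((5 : ℝ) / 2) / Real.sqrt ℓ = q * L ^ 2 := by
      rw [hq, Real.sqrt_div (by positivity), show (5 : ℝ) / 2 = 1 / 2 + 2 by norm_num,
        Real.rpow_add (by linarith), Real.rpow_two, ← Real.sqrt_eq_rpow]
      ring
    rw [mul_div_assoc, hLpow]
    push_cast
    calc 1 / 1024 * (q * L ^ 2) = q / 4 * (L / 16) * (L / 16) := by ring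
      _ ≤ t * a * a := by gcongr
end

section
/- For every real constant C > e², there exists r_0 such that for all integers r ≥ r_0, g(⌊r^{(log C)/2}⌋, ⌊r^{r/(2C)}⌋) ≤ r; that is, the grid graph Γ_{m,n} with m = ⌊r^{(log C)/2}⌋ and n = ⌊r^{r/(2C)}⌋ admits an alternating-free edge coloring with r colors. -/
/-- A proper `R`-coloring of the graph of edges on which the edge colorings `c` and `c'` agree. -/
def AgreeColorable {V α : Type} (c c' : Sym2 V → α) (R : ℕ) : Prop :=
  ∃ χ : V → Fin R, ∀ x y, x ≠ y → c s(x, y) = c' s(x, y) → χ x ≠ χ y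

/-- A finite family of `r`-edge-colorings of the complete graph on `N` vertices such that, for each
member, all but a proportion `p` of the family has an `R`-colorable agreement graph with it. -/
def HasSystem (r N R : ℕ) (p : ℝ) : Prop :=
  ∃ (V Ω : Type) (_ : Fintype V) (_ : Fintype Ω) (c : Ω → Sym2 V → Fin r),
    Fintype.card V = N ∧ Nonempty Ω ∧
    ∀ ω, ∃ B : Finset Ω, (B.card : ℝ) ≤ p * Fintype.card Ω ∧
      ∀ ω' ∉ B, AgreeColorable (c ω) (c ω') R

theorem Fin.exists_greedy {n : ℕ} {β : Type*} [Nonempty β] (Q : Fin n → Fin n → β → β → Prop)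
    (h : ∀ (a : Fin n) (g : Fin n → β), ∃ x, ∀ b < a, Q a b x (g b)) :
    ∃ γ : Fin n → β, ∀ a b, b < a → Q a b (γ a) (γ b) := by
  classical
  choose F hF using h
  let γ : Fin n → β := (wellFounded_lt (α := Fin n)).fix fun a ih =>
    F a fun b => if hb : b < a then ih b hb else Classical.arbitrary β
  have hγ : ∀ a, γ a = F a fun b => if b < a then γ b else Classical.arbitrary β := fun a => by
    simp only [γ]
    rw [WellFounded.fix_eq]
    simp
  refine ⟨γ, fun a b hb => ?_⟩
  have := hF a (fun b => if b < a then γ b else Classical.arbitrary β) b hb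
  rw [← hγ, if_pos hb] at this
  exact this

theorem Fin.exists_coloring_of_card_lt {M k : ℕ} (A : Fin M → Finset (Fin M))
    (hA : ∀ a, (A a).card < k) :
    ∃ γ : Fin M → Fin k, ∀ a b, b < a → b ∈ A a → γ a ≠ γ b := by
  classical
  rcases isEmpty_or_nonempty (Fin M) with hM | ⟨⟨a₀⟩⟩
  · exact ⟨isEmptyElim, isEmptyElim⟩
  have : Nonempty (Fin k) := ⟨⟨0, (Nat.zero_le _).trans_lt (hA a₀)⟩⟩
  refine Fin.exists_greedy (fun a b x y => b ∈ A a → x ≠ y) fun a g => ?_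
  have hcard : ((A a).image g).card < (Finset.univ : Finset (Fin k)).card := by
    rw [Finset.card_univ, Fintype.card_fin]
    exact Finset.card_image_le.trans_lt (hA a)
  obtain ⟨x, -, hx⟩ := Finset.exists_mem_notMem_of_card_lt_card hcard
  refine ⟨x, fun b _ hb hxb => hx ?_⟩
  rw [hxb]
  exact Finset.mem_image_of_mem g hb

/-- Union bound for the number of functions hitting at least `t` of the prescribed small sets. -/
theorem card_filter_le_card_mem {ι A : Type*} [Fintype ι] [DecidableEq ι] [Fintype A]
    [DecidableEq A] (B : ι → Finset A) {p : ℝ}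
    (hp : 0 ≤ p) (hB : ∀ i, ((B i).card : ℝ) ≤ p * Fintype.card A) (t : ℕ) :
    (((Finset.univ : Finset (ι → A)).filter fun f =>
      t ≤ ((Finset.univ : Finset ι).filter fun i => f i ∈ B i).card).card : ℝ) ≤
      (Fintype.card ι * p) ^ t * Fintype.card (ι → A) := by
  set W : Finset ι → Finset (ι → A) := fun S =>
    Fintype.piFinset fun i => if i ∈ S then B i else Finset.univ
  have hsub : ((Finset.univ : Finset (ι → A)).filter fun f =>
      t ≤ ((Finset.univ : Finset ι).filter fun i => f i ∈ B i).card) ⊆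
      (Finset.powersetCard t Finset.univ).biUnion W := by
    intro f hf
    rw [Finset.mem_filter] at hf
    obtain ⟨S, hS, hSc⟩ := Finset.exists_subset_card_eq hf.2
    refine Finset.mem_biUnion.2 ⟨S, Finset.mem_powersetCard.2 ⟨Finset.subset_univ _, hSc⟩, ?_⟩
    refine Fintype.mem_piFinset.2 fun i => ?_
    split_ifs with hi
    · exact (Finset.mem_filter.1 (hS hi)).2
    · exact Finset.mem_univ _
  have hW : ∀ S ∈ Finset.powersetCard t (Finset.univ : Finset ι),
      ((W S).card : ℝ) ≤ p ^ t * Fintype.card (ι → A) := by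
    intro S hS
    rw [Finset.mem_powersetCard] at hS
    calc ((W S).card : ℝ)
        = ∏ i, (((if i ∈ S then B i else Finset.univ).card : ℕ) : ℝ) := by
          simp only [W, Fintype.card_piFinset, Nat.cast_prod]
      _ ≤ ∏ i, ((if i ∈ S then p else 1) * (Fintype.card A : ℝ)) := by
          refine Finset.prod_le_prod (fun _ _ => Nat.cast_nonneg _) fun i _ => ?_
          split_ifs
          · exact hB i
          · simp
      _ = p ^ t * Fintype.card (ι → A) := by
          rw [Finset.prod_mul_distrib, Finset.prod_ite_mem, Finset.univ_inter, Finset.prod_const,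
            Finset.prod_const, hS.2, Fintype.card_fun, Finset.card_univ]
          push_cast
          rfl
  calc _ ≤ (((Finset.powersetCard t Finset.univ).biUnion W).card : ℝ) := by
        exact_mod_cast Finset.card_le_card hsub
    _ ≤ ∑ S ∈ Finset.powersetCard t (Finset.univ : Finset ι), ((W S).card : ℝ) := by
        exact_mod_cast Finset.card_biUnion_le
    _ ≤ ∑ S ∈ Finset.powersetCard t (Finset.univ : Finset ι),
          p ^ t * (Fintype.card (ι → A) : ℝ) := Finset.sum_le_sum hW
    _ = (Fintype.card ι).choose t * (p ^ t * (Fintype.card (ι → A) : ℝ)) := by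
        rw [Finset.sum_const, Finset.card_powersetCard, nsmul_eq_mul, Finset.card_univ]
    _ ≤ (Fintype.card ι : ℝ) ^ t * (p ^ t * (Fintype.card (ι → A) : ℝ)) := by
        gcongr
        exact_mod_cast Nat.choose_le_pow _ _
    _ = _ := by ring

theorem hasSystem_one {r : ℕ} (hr : 0 < r) : HasSystem r 1 1 0 :=
  ⟨Unit, Unit, inferInstance, inferInstance, fun _ _ => ⟨0, hr⟩, rfl, inferInstance,
    fun _ => ⟨∅, by simp, fun _ _ => ⟨fun _ => 0, fun _ _ h => (h rfl).elim⟩⟩⟩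

/-- The coloring of the lexicographic product of a colored complete graph with complete graphs on
`Fin M`, one for each vertex. -/
def lexColoring {V α : Type} [DecidableEq V] {M : ℕ} (c : Sym2 V → α)
    (f : V × Fin M → Fin M → α) : Sym2 (V × Fin M) → α :=
  Sym2.lift ⟨fun x y => if x.1 = y.1 then f (x.1, max x.2 y.2) (min x.2 y.2) else c s(x.1, y.1),
    fun x y => by
      dsimp only
      by_cases h : x.1 = y.1
      · rw [if_pos h, if_pos h.symm, h, max_comm, min_comm]
      · rw [if_neg h, if_neg (Ne.symm h), Sym2.eq_swap]⟩

theorem agreeColorable_lexColoring {V α : Type} [Fintype V] [DecidableEq V] [DecidableEq α]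
    {M R k t : ℕ}
    {c c' : Sym2 V → α} {f f' : V × Fin M → Fin M → α} (hk : 0 < k)
    (hc : AgreeColorable c c' R)
    (hf : ((Finset.univ : Finset (V × Fin M)).filter fun v =>
      k ≤ ((Finset.univ : Finset (Fin M)).filter fun b => f v b = f' v b).card).card ≤ t) :
    AgreeColorable (lexColoring c f) (lexColoring c' f') (R * k + t) := by
  obtain ⟨χ, hχ⟩ := hc
  set A : V × Fin M → Finset (Fin M) := fun v => Finset.univ.filter fun b => f v b = f' v b
  set T : Finset (V × Fin M) := Finset.univ.filter fun v => k ≤ (A v).card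
  have hγ : ∀ v : V, ∃ γ : Fin M → Fin k, ∀ a b, b < a →
      b ∈ (if (v, a) ∈ T then ∅ else A (v, a)) → γ a ≠ γ b := fun v => by
    refine Fin.exists_coloring_of_card_lt _ fun a => ?_
    split_ifs with h
    · simpa using hk
    · simpa [T] using h
  choose γ hγ using hγ
  let col : V × Fin M → (Fin R × Fin k) ⊕ T := fun v =>
    if h : v ∈ T then Sum.inr ⟨v, h⟩ else Sum.inl (χ v.1, γ v.1 v.2)
  have hcol : ∀ x y, x ≠ y → lexColoring c f s(x, y) = lexColoring c' f' s(x, y) →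
      col x ≠ col y := by
    have key : ∀ (v : V) (a b : Fin M), b < a → (v, a) ∉ T → f (v, a) b = f' (v, a) b →
        γ v a ≠ γ v b := fun v a b hb hT hab => hγ v a b hb (by simp [hT, A, hab])
    rintro ⟨v, a⟩ ⟨w, b⟩ hne hagree heq
    by_cases hx : (v, a) ∈ T <;> by_cases hy : (w, b) ∈ T <;>
      simp only [col, hx, hy, dif_pos, dif_neg, not_false_eq_true, reduceCtorEq, Sum.inr.injEq,
        Sum.inl.injEq, Subtype.mk.injEq, Prod.mk.injEq] at heq
    · exact hne (Prod.ext heq.1 heq.2)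
    · by_cases hvw : v = w
      · subst hvw
        have hab : a ≠ b := fun h => hne (by rw [h])
        simp only [lexColoring, Sym2.lift_mk, if_true] at hagree
        rcases lt_or_gt_of_ne hab with h | h
        · rw [max_eq_right h.le, min_eq_left h.le] at hagree
          exact key v b a h hy hagree heq.2.symm
        · rw [max_eq_left h.le, min_eq_right h.le] at hagree
          exact key v a b h hx hagree heq.2
      · simp only [lexColoring, Sym2.lift_mk, if_neg hvw] at hagree
        exact hχ v w hvw hagree heq.1
  have hcard : Fintype.card ((Fin R × Fin k) ⊕ T) ≤ Fintype.card (Fin (R * k + t)) := by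
    simpa using hf
  obtain ⟨e⟩ := Function.Embedding.nonempty_of_card_le hcard
  exact ⟨e ∘ col, fun x y hxy h he => hcol x y hxy h (e.injective he)⟩

theorem HasSystem.lex {r N R : ℕ} {p : ℝ} (hr : 0 < r) (hs : HasSystem r N R p) (M : ℕ) {k : ℕ}
    (hk : 0 < k) (t : ℕ) :
    HasSystem r (N * M) (R * k + t)
      (p + ((N * M : ℕ) * ((M : ℝ) * (r : ℝ)⁻¹) ^ k) ^ t) := by
  obtain ⟨V, Ω, _, _, c, hV, hΩ, hc⟩ := hs
  classical
  have hr' : (r : ℝ) ≠ 0 := by positivity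
  have : NeZero r := ⟨hr.ne'⟩
  refine ⟨V × Fin M, Ω × (V × Fin M → Fin M → Fin r), inferInstance, inferInstance,
    fun ω => lexColoring (c ω.1) ω.2, by simp [hV], inferInstance, ?_⟩
  rintro ⟨ω, f⟩
  obtain ⟨B, hB, hBc⟩ := hc ω
  let D : V × Fin M → Finset (Fin M → Fin r) := fun v => Finset.univ.filter fun g =>
    k ≤ ((Finset.univ : Finset (Fin M)).filter fun b => g b ∈ ({f v b} : Finset (Fin r))).card
  have hD : ∀ v, ((D v).card : ℝ) ≤
      ((M : ℝ) * (r : ℝ)⁻¹) ^ k * Fintype.card (Fin M → Fin r) := fun v => by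
    have := card_filter_le_card_mem (fun b : Fin M => ({f v b} : Finset (Fin r)))
      (p := (r : ℝ)⁻¹) (by positivity) (fun i => by simp [hr']) k
    rwa [Fintype.card_fin] at this
  let E : Finset (V × Fin M → Fin M → Fin r) := Finset.univ.filter fun f' =>
    t ≤ ((Finset.univ : Finset (V × Fin M)).filter fun v => f' v ∈ D v).card
  have hE : (E.card : ℝ) ≤ ((N * M : ℕ) * ((M : ℝ) * (r : ℝ)⁻¹) ^ k) ^ t *
      Fintype.card (V × Fin M → Fin M → Fin r) := by
    have := card_filter_le_card_mem D (by positivity) hD t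
    rwa [Fintype.card_prod, hV, Fintype.card_fin] at this
  refine ⟨B ×ˢ Finset.univ ∪ Finset.univ ×ˢ E, ?_, ?_⟩
  · calc ((B ×ˢ Finset.univ ∪ Finset.univ ×ˢ E :
          Finset (Ω × (V × Fin M → Fin M → Fin r))).card : ℝ)
        ≤ B.card * Fintype.card (V × Fin M → Fin M → Fin r) + Fintype.card Ω * E.card := by
          have := Finset.card_union_le (B ×ˢ (Finset.univ : Finset (V × Fin M → Fin M → Fin r)))
            ((Finset.univ : Finset Ω) ×ˢ E)
          rw [Finset.card_product, Finset.card_product, Finset.card_univ, Finset.card_univ] at this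
          exact_mod_cast this
      _ ≤ p * Fintype.card Ω * Fintype.card (V × Fin M → Fin M → Fin r) + Fintype.card Ω *
            (((N * M : ℕ) * ((M : ℝ) * (r : ℝ)⁻¹) ^ k) ^ t *
              Fintype.card (V × Fin M → Fin M → Fin r)) := by gcongr
      _ = _ := by
          rw [Fintype.card_prod]
          push_cast
          ring
  · rintro ⟨ω', f'⟩ h
    simp only [Finset.mem_union, Finset.mem_product, Finset.mem_univ, and_true, true_and,
      not_or] at h
    refine agreeColorable_lexColoring hk (hBc ω' h.1) ?_
    have h2 : ¬ t ≤ ((Finset.univ : Finset (V × Fin M)).filter fun v => f' v ∈ D v).card := by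
      simpa only [E, Finset.mem_filter, Finset.mem_univ, true_and] using h.2
    refine le_trans (le_of_eq ?_) (not_le.1 h2).le
    congr 1
    ext v
    simp [D, eq_comm]

theorem HasSystem.exists_coloring {r N R m n : ℕ} {p : ℝ} (hs : HasSystem r N R p) (hR : R ≤ r)
    (hn : n * p < 1) (hm : m ≤ N) :
    ∃ col : Sym2 (Fin m × Fin n) → Fin r, ¬ HasAltRect col := by
  classical
  obtain ⟨V, Ω, _, _, c, hV, hΩ, hc⟩ := hs
  obtain ⟨e⟩ : Nonempty (Fin m ↪ V) :=
    Function.Embedding.nonempty_of_card_le (by simpa [hV] using hm)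
  choose B hB hBc using hc
  obtain ⟨w, hw⟩ := Fin.exists_greedy (n := n)
    (fun _ _ x y => AgreeColorable (c y) (c x) R) (fun a g => by
      have h1 : ((Finset.univ.biUnion fun b => B (g b)).card : ℝ) < Fintype.card Ω := by
        calc ((Finset.univ.biUnion fun b => B (g b)).card : ℝ)
            ≤ ∑ b : Fin n, ((B (g b)).card : ℝ) := by exact_mod_cast Finset.card_biUnion_le
          _ ≤ ∑ _b : Fin n, p * (Fintype.card Ω : ℝ) := Finset.sum_le_sum fun b _ => hB _
          _ = (n * p) * Fintype.card Ω := by simp [mul_assoc]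
          _ < 1 * Fintype.card Ω := by
              have : (0 : ℝ) < Fintype.card Ω := by exact_mod_cast Fintype.card_pos
              gcongr
          _ = _ := one_mul _
      obtain ⟨x, -, hx⟩ := Finset.exists_mem_notMem_of_card_lt_card
        (s := Finset.univ.biUnion fun b => B (g b)) (t := Finset.univ) (by
          rw [Finset.card_univ]
          exact_mod_cast h1)
      refine ⟨x, fun b _ => hBc _ _ fun hxb => hx ?_⟩
      exact Finset.mem_biUnion.2 ⟨b, Finset.mem_univ _, hxb⟩)
  have hχ : ∀ j j' : Fin n, ∃ χ : V → Fin r, j < j' → ∀ x y, x ≠ y →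
      c (w j) s(x, y) = c (w j') s(x, y) → χ x ≠ χ y := fun j j' => by
    by_cases h : j < j'
    · obtain ⟨χ, hχ⟩ := hw j' j h
      refine ⟨fun x => Fin.castLE hR (χ x), fun _ x y hxy ha he => hχ x y hxy ha ?_⟩
      exact Fin.castLE_injective hR he
    · exact ⟨fun x => c (w j) s(x, x), fun h' => (h h').elim⟩
  choose χ hχ using hχ
  refine ⟨Sym2.lift ⟨fun x y => if x.2 = y.2 then c (w x.2) s(e x.1, e y.1) else
    χ (min x.2 y.2) (max x.2 y.2) (e (min x.1 y.1)), fun x y => ?_⟩, ?_⟩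
  · dsimp only
    by_cases h : x.2 = y.2
    · rw [if_pos h, if_pos h.symm, h, Sym2.eq_swap]
    · rw [if_neg h, if_neg (Ne.symm h), min_comm, max_comm, min_comm x.1]
  · rintro ⟨i, i', j, j', hi, hj, hcol, hrow⟩
    simp only [Sym2.lift_mk, if_true, hj.ne, if_false, min_self, min_eq_left hj.le,
      max_eq_right hj.le] at hcol hrow
    exact hχ j j' hj (e i) (e i') (fun h => hi.ne (e.injective h)) hcol hrow

theorem HasSystem.mono {r N R : ℕ} {p q : ℝ} (hs : HasSystem r N R p) (hpq : p ≤ q) :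
    HasSystem r N R q := by
  obtain ⟨V, Ω, _, _, c, hV, hΩ, hc⟩ := hs
  refine ⟨V, Ω, inferInstance, inferInstance, c, hV, hΩ, fun ω => ?_⟩
  obtain ⟨B, hB, hBc⟩ := hc ω
  exact ⟨B, hB.trans (by gcongr), hBc⟩

theorem hasSystem_iterate {r s D h : ℕ} (hD : D = 2 * 3 ^ h) (hs : D * h + 2 ≤ s)
    (hsr : s ^ D ≤ r) (i j : ℕ) (hij : i + j = h) :
    HasSystem r (s ^ ((D - 1) * i)) (2 ^ i * s ^ (D - 2 * 3 ^ j))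
      (i * ((s : ℝ)⁻¹) ^ s ^ (D + 1)) := by
  have hs0 : 0 < s := by omega
  have hr : 0 < r := (pow_pos hs0 D).trans_le hsr
  induction i generalizing j with
  | zero =>
    obtain rfl : j = h := by omega
    simpa [hD] using hasSystem_one hr
  | succ i ih =>
    have hw : 1 ≤ 3 ^ j := Nat.one_le_pow _ _ (by norm_num)
    have hDw : 6 * 3 ^ j ≤ D := by
      have : 3 ^ (j + 1) ≤ 3 ^ h := Nat.pow_le_pow_right (by norm_num) (by omega)
      rw [pow_succ] at this
      omega
    set w := 3 ^ j with hwdef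
    have hstep := (ih (j + 1) (by omega)).lex hr (s ^ (D - 1)) (k := s ^ (4 * w)) (by positivity)
      (2 ^ i * s ^ (D - 2 * w))
    have hRk : 2 ^ i * s ^ (D - 2 * 3 ^ (j + 1)) * s ^ (4 * w) = 2 ^ i * s ^ (D - 2 * w) := by
      rw [mul_assoc, ← pow_add, pow_succ, ← hwdef]
      congr 2
      omega
    have hN : s ^ ((D - 1) * i) * s ^ (D - 1) = s ^ ((D - 1) * (i + 1)) := by
      rw [← pow_add, mul_add, mul_one]
    rw [hRk, hN, ← two_mul, ← mul_assoc, ← pow_succ'] at hstep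
    refine hstep.mono ?_
    have hsR : (0 : ℝ) < s := by exact_mod_cast hs0
    have hs1 : (s : ℝ)⁻¹ ≤ 1 := inv_le_one_of_one_le₀ (by exact_mod_cast hs0)
    have hM : ((s ^ (D - 1) : ℕ) : ℝ) * (r : ℝ)⁻¹ ≤ (s : ℝ)⁻¹ := by
      rw [← div_eq_mul_inv, div_le_iff₀ (by exact_mod_cast hr), inv_mul_eq_div,
        le_div_iff₀ hsR]
      have : s ^ (D - 1) * s ≤ r := by
        rw [← pow_succ, Nat.sub_add_cancel (by omega)]
        exact hsr
      exact_mod_cast this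
    have hexp : (D - 1) * (i + 1) + s ^ (4 * w - 1) ≤ s ^ (4 * w) := by
      have h1 : (D - 1) * (i + 1) ≤ D * h := Nat.mul_le_mul (by omega) (by omega)
      have h2 : s ^ (4 * w) = s ^ (4 * w - 1) * s := by
        rw [← pow_succ, Nat.sub_add_cancel (by omega)]
      have h3 : s ≤ s ^ (4 * w - 1) := Nat.le_self_pow (by omega) s
      rw [h2]
      nlinarith
    have hbad : ((s ^ ((D - 1) * (i + 1)) : ℕ) : ℝ) *
        (((s ^ (D - 1) : ℕ) : ℝ) * (r : ℝ)⁻¹) ^ s ^ (4 * w) ≤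
        ((s : ℝ)⁻¹) ^ s ^ (4 * w - 1) := by
      calc _ ≤ ((s ^ ((D - 1) * (i + 1)) : ℕ) : ℝ) * ((s : ℝ)⁻¹) ^ s ^ (4 * w) := by gcongr
        _ ≤ ((s ^ ((D - 1) * (i + 1)) : ℕ) : ℝ) *
            ((s : ℝ)⁻¹) ^ ((D - 1) * (i + 1) + s ^ (4 * w - 1)) := by
          gcongr ?_ * ?_
          exact pow_le_pow_of_le_one (by positivity) hs1 hexp
        _ = _ := by
          rw [pow_add, ← mul_assoc, Nat.cast_pow, ← mul_pow, mul_inv_cancel₀ hsR.ne', one_pow,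
            one_mul]
    have hexp' : s ^ (D + 1) ≤ s ^ (4 * w - 1) * (2 ^ i * s ^ (D - 2 * w)) := by
      calc s ^ (D + 1) ≤ s ^ (4 * w - 1 + (D - 2 * w)) := Nat.pow_le_pow_right hs0 (by omega)
        _ = s ^ (4 * w - 1) * (1 * s ^ (D - 2 * w)) := by rw [pow_add, one_mul]
        _ ≤ _ := by
          gcongr
          exact Nat.one_le_two_pow
    have : (((s ^ ((D - 1) * (i + 1)) : ℕ) : ℝ) *
        (((s ^ (D - 1) : ℕ) : ℝ) * (r : ℝ)⁻¹) ^ s ^ (4 * w)) ^ (2 ^ i * s ^ (D - 2 * w)) ≤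
        ((s : ℝ)⁻¹) ^ s ^ (D + 1) := by
      calc _ ≤ (((s : ℝ)⁻¹) ^ s ^ (4 * w - 1)) ^ (2 ^ i * s ^ (D - 2 * w)) := by gcongr
        _ = ((s : ℝ)⁻¹) ^ (s ^ (4 * w - 1) * (2 ^ i * s ^ (D - 2 * w))) := (pow_mul _ _ _).symm
        _ ≤ _ := pow_le_pow_of_le_one (by positivity) hs1 hexp'
    push_cast at this ⊢
    linarith

theorem Nat.exists_pow_le_lt_succ_pow {D : ℕ} (hD : D ≠ 0) (r : ℕ) :
    ∃ s, s ^ D ≤ r ∧ r < (s + 1) ^ D := by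
  refine ⟨Nat.findGreatest (fun s => s ^ D ≤ r) r, ?_, ?_⟩
  · exact Nat.findGreatest_spec (P := fun s => s ^ D ≤ r) (Nat.zero_le r) (by simp [hD])
  · by_contra! hlt
    have := Nat.le_findGreatest (P := fun s => s ^ D ≤ r) ((Nat.le_self_pow hD _).trans hlt) hlt
    omega

/-- For every real `C > e²` and all sufficiently large `r`, the grid graph `Γ_{m,n}`
with `m = ⌊r^{(log C)/2}⌋` and `n = ⌊r^{r/(2C)}⌋` admits an alternating-free edge
coloring with `r` colors, i.e. `g(⌊r^{(log C)/2}⌋, ⌊r^{r/(2C)}⌋) ≤ r`. -/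
theorem grid_ramsey_asymmetric_i :
    ∀ C : ℝ, Real.exp 2 < C → ∃ r0 : ℕ, ∀ r : ℕ, r0 ≤ r →
      ∃ col : Sym2 (Fin (⌊(r : ℝ) ^ (Real.logb 2 C / 2)⌋₊) ×
          Fin (⌊(r : ℝ) ^ ((r : ℝ) / (2 * C))⌋₊)) → Fin r,
        ¬ HasAltRect col := by
  intro C hC
  have hC1 : 1 ≤ C := (Real.one_le_exp (by norm_num)).trans hC.le
  set a : ℝ := Real.logb 2 C / 2
  obtain ⟨h, hh⟩ : ∃ h : ℕ, 4 * a ≤ h := exists_nat_ge _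
  obtain ⟨D, hD⟩ : ∃ D, D = 2 * 3 ^ h := ⟨_, rfl⟩
  have hD2 : 2 ≤ D := by
    have : 1 ≤ 3 ^ h := Nat.one_le_pow _ _ (by norm_num)
    omega
  set S := D * h + 2 + 2 ^ h + 2 * D * 2 ^ D with hS
  refine ⟨S ^ D, fun r hr => ?_⟩
  obtain ⟨s, hsr, hrs⟩ := Nat.exists_pow_le_lt_succ_pow (D := D) (by omega) r
  have hSs : S ≤ s :=
    Nat.lt_succ_iff.1 (lt_of_pow_lt_pow_left₀ D (Nat.zero_le _) (hr.trans_lt hrs))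
  have h2pos : 0 < 2 ^ h := by positivity
  have hs2 : 2 ≤ s := by omega
  have hsR : (1 : ℝ) < s := by exact_mod_cast hs2
  have hr1 : 1 ≤ r := (Nat.one_le_pow D s (by omega)).trans hsr
  have hrR : (1 : ℝ) ≤ r := by exact_mod_cast hr1
  have hrs' : r ≤ 2 ^ D * s ^ D := by
    rw [← mul_pow]
    exact hrs.le.trans (Nat.pow_le_pow_left (by omega) D)
  have hrs2 : r ≤ s ^ (2 * D) := by
    refine hrs'.trans ?_
    rw [two_mul, pow_add]
    gcongr
  have hsys := hasSystem_iterate hD (by omega : D * h + 2 ≤ s) hsr h 0 (by omega)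
  have h2h : 2 ^ h ≤ s := by omega
  have hhs : h < s := Nat.lt_two_pow_self.trans_le h2h
  refine hsys.exists_coloring ?_ ?_ ?_
  · calc 2 ^ h * s ^ (D - 2 * 3 ^ 0) ≤ s * s ^ (D - 2 * 3 ^ 0) := by gcongr
      _ = s ^ (D - 2 * 3 ^ 0 + 1) := (pow_succ' _ _).symm
      _ ≤ s ^ D := Nat.pow_le_pow_right (by omega) (by omega)
      _ ≤ r := hsr
  · have hn : ⌊(r : ℝ) ^ ((r : ℝ) / (2 * C))⌋₊ ≤ s ^ (2 * D * (2 ^ D * s ^ D)) := by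
      refine Nat.floor_le_of_le ?_
      calc (r : ℝ) ^ ((r : ℝ) / (2 * C)) ≤ (r : ℝ) ^ (r : ℝ) :=
            Real.rpow_le_rpow_of_exponent_le hrR (div_le_self (by positivity) (by linarith))
        _ = ((r ^ r : ℕ) : ℝ) := by rw [Real.rpow_natCast, Nat.cast_pow]
        _ ≤ _ := by
          refine Nat.cast_le.2 ?_
          rw [pow_mul]
          exact (Nat.pow_le_pow_left hrs2 r).trans
            (Nat.pow_le_pow_right (Nat.pow_pos (by omega)) hrs')
    have hexp : 2 * D * (2 ^ D * s ^ D) + 1 ≤ s ^ (D + 1) := by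
      have h1 : 2 * D * 2 ^ D + 1 ≤ s := by omega
      have h2 : 1 ≤ s ^ D := Nat.one_le_pow _ _ (by omega)
      calc _ ≤ (2 * D * 2 ^ D + 1) * s ^ D := by nlinarith
        _ ≤ s * s ^ D := by gcongr
        _ = _ := (pow_succ' _ _).symm
    have hlt : ⌊(r : ℝ) ^ ((r : ℝ) / (2 * C))⌋₊ * h < s ^ s ^ (D + 1) := by
      calc _ ≤ s ^ (2 * D * (2 ^ D * s ^ D)) * h := by gcongr
        _ < s ^ (2 * D * (2 ^ D * s ^ D)) * s := by gcongr
        _ = s ^ (2 * D * (2 ^ D * s ^ D) + 1) := (pow_succ _ _).symm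
        _ ≤ _ := Nat.pow_le_pow_right (by omega) hexp
    rw [← mul_assoc, inv_pow, ← div_eq_mul_inv, div_lt_one (by positivity)]
    exact_mod_cast hlt
  · refine Nat.floor_le_of_le ?_
    have ha : 0 ≤ a := div_nonneg (Real.logb_nonneg (by norm_num) hC1) (by norm_num)
    calc (r : ℝ) ^ a ≤ ((s : ℝ) ^ ((2 * D : ℕ) : ℝ)) ^ a := by
          refine Real.rpow_le_rpow (by positivity) ?_ ha
          rw [Real.rpow_natCast]
          exact_mod_cast hrs2
      _ = (s : ℝ) ^ (((2 * D : ℕ) : ℝ) * a) := (Real.rpow_mul (by positivity) _ _).symm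
      _ ≤ (s : ℝ) ^ (((D - 1) * h : ℕ) : ℝ) := by
          refine Real.rpow_le_rpow_of_exponent_le hsR.le ?_
          rw [Nat.cast_mul (D - 1), Nat.cast_sub (by omega : 1 ≤ D)]
          push_cast
          have hD2R : (2 : ℝ) ≤ D := by exact_mod_cast hD2
          nlinarith
      _ = _ := by rw [Real.rpow_natCast, Nat.cast_pow]
end

section
/- For every positive real constant ε, there exists r_0 such that for all integers r ≥ r_0, g(⌊2^{ε (log r)²}⌋, ⌊2^{r^{1−ε}}⌋) ≤ r; that is, the grid graph Γ_{m,n} with m = ⌊2^{ε (log r)²}⌋ and n = ⌊2^{r^{1−ε}}⌋ admits an alternating-free edge coloring with r colors. -/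
/-- It suffices to color row edges and column edges separately. -/
theorem exists_not_hasAltRect_of_separate {m n : ℕ} {α : Type*} (R : Fin m → Sym2 (Fin n) → α)
    (C : Fin n → Sym2 (Fin m) → α)
    (h : ∀ i i' j j', i ≠ i' → j ≠ j' → C j s(i, i') = C j' s(i, i') →
      R i s(j, j') ≠ R i' s(j, j')) :
    ∃ col : Sym2 (Fin m × Fin n) → α, ¬ HasAltRect col := by
  refine ⟨Sym2.lift ⟨fun p p' => if p.1 = p'.1 then R p.1 s(p.2, p'.2)
    else C (min p.2 p'.2) s(p.1, p'.1), fun p p' => ?_⟩, ?_⟩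
  · by_cases hp : p.1 = p'.1
    · simp [hp, Sym2.eq_swap]
    · simp [hp, Ne.symm hp, min_comm, Sym2.eq_swap]
  · rintro ⟨i, i', j, j', hi, hj, hc, hr⟩
    simp only [Sym2.lift_mk, hi.ne, if_false, if_true, min_self] at hc hr
    exact h i i' j j' hi.ne hj.ne hc hr

/-- A family of words pairwise agreeing in at most `k` positions yields an alternating-free
coloring. -/
theorem exists_not_hasAltRect_of_code {m n r k : ℕ} {K : Type*} [Fintype K] [DecidableEq K]
    (e : Fin n → K → Bool) (he : Function.Injective e) (F : Fin m → K → K)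
    (hF : ∀ i i', i ≠ i' → (Finset.univ.filter fun a => F i a = F i' a).card ≤ k)
    (hk : 2 ^ k ≤ r) (hK : Fintype.card K ≤ r) :
    ∃ col : Sym2 (Fin m × Fin n) → Fin r, ¬ HasAltRect col := by
  obtain hn | hn := subsingleton_or_nontrivial (Fin n)
  · have : NeZero r := ⟨by have := Nat.two_pow_pos k; omega⟩
    exact ⟨fun _ => 0, fun ⟨_, _, j, j', _, hj, _⟩ => hj.ne (Subsingleton.elim _ _)⟩
  have hδ : ∀ z : Sym2 (Fin n), ∃ a : K, ∀ j j', z = s(j, j') → j ≠ j' → e j a ≠ e j' a := by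
    obtain ⟨x, y, hxy⟩ := exists_pair_ne (Fin n)
    obtain ⟨a₀, -⟩ := Function.ne_iff.1 (he.ne hxy)
    intro z
    induction z with
    | _ x y =>
      by_cases hxy : x = y
      · refine ⟨a₀, fun j j' h hj => ?_⟩
        subst hxy
        rw [Sym2.eq_iff] at h
        grind
      · obtain ⟨a, ha⟩ := Function.ne_iff.1 (he.ne hxy)
        refine ⟨a, fun j j' h hj => ?_⟩
        rw [Sym2.eq_iff] at h
        grind
  have hg : ∀ z : Sym2 (Fin m), ∃ g : Fin n → Fin r, ∀ i i', z = s(i, i') → i ≠ i' →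
      ∀ a, F i a = F i' a → ∀ j j', g j = g j' → e j a = e j' a := by
    intro z
    induction z with
    | _ x y =>
      by_cases hxy : x = y
      · have : NeZero r := ⟨by have := Nat.two_pow_pos k; omega⟩
        refine ⟨fun _ => 0, fun i i' h hi => ?_⟩
        subst hxy
        rw [Sym2.eq_iff] at h
        grind
      · have hcard : Fintype.card ({a // F x a = F y a} → Bool) ≤ Fintype.card (Fin r) := by
          rw [Fintype.card_fun, Fintype.card_bool, Fintype.card_fin, Fintype.card_subtype]
          exact (Nat.pow_le_pow_right (by simp) (hF x y hxy)).trans hk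
        obtain ⟨φ⟩ := Function.Embedding.nonempty_of_card_le hcard
        refine ⟨fun j => φ fun a => e j a, fun i i' h hi a ha j j' hj => ?_⟩
        have hxa : F x a = F y a := by
          rw [Sym2.eq_iff] at h
          grind
        exact congrFun (φ.injective hj) ⟨a, hxa⟩
  choose δ hδ using hδ
  choose g hg using hg
  obtain ⟨ψ⟩ : Nonempty (K ↪ Fin r) :=
    Function.Embedding.nonempty_of_card_le (by simpa using hK)
  refine exists_not_hasAltRect_of_separate (fun i z => ψ (F i (δ z))) (fun j z => g z j) ?_
  intro i i' j j' hi hj hc hr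
  exact hδ _ j j' rfl hj (hg _ i i' rfl hi _ (ψ.injective hr) j j' hc)

/-- Reed–Solomon codes: evaluation vectors of polynomials of degree at most `k`. -/
theorem exists_code_of_le_card_pow {K : Type*} [Field K] [Fintype K] [DecidableEq K] {m k : ℕ}
    (hm : m ≤ Fintype.card K ^ (k + 1)) :
    ∃ F : Fin m → K → K,
      ∀ i i', i ≠ i' → (Finset.univ.filter fun a => F i a = F i' a).card ≤ k := by
  obtain ⟨v⟩ : Nonempty (Fin m ↪ (Fin (k + 1) → K)) :=
    Function.Embedding.nonempty_of_card_le (by simpa using hm)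
  let P : Fin m → Polynomial K := fun i => ((Polynomial.degreeLTEquiv K (k + 1)).symm (v i)).1
  have hP : Function.Injective P := fun i i' h =>
    v.injective ((Polynomial.degreeLTEquiv K (k + 1)).symm.injective (Subtype.ext h))
  refine ⟨fun i a => (P i).eval a, fun i i' hi => ?_⟩
  have hne : P i - P i' ≠ 0 := sub_ne_zero.2 (hP.ne hi)
  have hdeg : (P i - P i').natDegree ≤ k := by
    have : P i - P i' ∈ Polynomial.degreeLT K (k + 1) :=
      Submodule.sub_mem _ (Subtype.prop _) (Subtype.prop _)
    rw [Polynomial.mem_degreeLT, ← Polynomial.natDegree_lt_iff_degree_lt hne] at this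
    omega
  refine (Polynomial.card_le_degree_of_subset_roots fun a ha => ?_).trans hdeg
  rw [Polynomial.mem_roots hne, Polynomial.IsRoot, Polynomial.eval_sub, sub_eq_zero]
  simpa using ha

theorem exists_not_hasAltRect_of_prime {m n r q : ℕ} (hq : q.Prime) (hqr : q ≤ r)
    (hn : n ≤ 2 ^ q) (hm : m ≤ q ^ (Nat.log 2 r + 1)) :
    ∃ col : Sym2 (Fin m × Fin n) → Fin r, ¬ HasAltRect col := by
  have : Fact q.Prime := ⟨hq⟩
  obtain ⟨F, hF⟩ := exists_code_of_le_card_pow (K := ZMod q) (m := m) (k := Nat.log 2 r)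
    (by simpa using hm)
  obtain ⟨e⟩ : Nonempty (Fin n ↪ (ZMod q → Bool)) :=
    Function.Embedding.nonempty_of_card_le (by simpa using hn)
  exact exists_not_hasAltRect_of_code e e.injective F hF
    (Nat.pow_log_le_self 2 (hq.pos.trans_le hqr).ne') (by simpa using hqr)

theorem exists_not_hasAltRect_of_le {m n r : ℕ} (hn : n ≤ r) :
    ∃ col : Sym2 (Fin m × Fin n) → Fin r, ¬ HasAltRect col := by
  obtain rfl | hr := Nat.eq_zero_or_pos r
  · obtain rfl : n = 0 := by omega
    exact ⟨fun z => z.out.1.2, fun ⟨_, _, j, _⟩ => j.elim0⟩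
  exact exists_not_hasAltRect_of_separate (fun _ _ => ⟨0, hr⟩) (fun j _ => Fin.castLE hn j)
    fun _ _ _ _ _ hj hc => absurd (Fin.castLE_injective hn hc) hj

/-- For every `ε > 0` and all sufficiently large `r`, the grid graph `Γ_{m,n}` with
`m = ⌊2^{ε (log r)²}⌋` and `n = ⌊2^{r^{1−ε}}⌋` admits an alternating-free edge
coloring with `r` colors, i.e. `g(⌊2^{ε (log r)²}⌋, ⌊2^{r^{1−ε}}⌋) ≤ r`. -/
theorem grid_ramsey_asymmetric_ii :
    ∀ ε : ℝ, 0 < ε → ∃ r0 : ℕ, ∀ r : ℕ, r0 ≤ r →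
      ∃ col : Sym2 (Fin (⌊(2 : ℝ) ^ (ε * (Real.logb 2 r) ^ 2)⌋₊) ×
          Fin (⌊(2 : ℝ) ^ ((r : ℝ) ^ (1 - ε))⌋₊)) → Fin r,
        ¬ HasAltRect col := by
  intro ε hε
  obtain h1 | h1 := le_or_gt 1 ε
  · refine ⟨2, fun r hr => exists_not_hasAltRect_of_le (Nat.floor_le_of_le ?_)⟩
    have hr' : (2 : ℝ) ≤ r := by exact_mod_cast hr
    refine le_trans ?_ hr'
    calc (2 : ℝ) ^ ((r : ℝ) ^ (1 - ε)) ≤ 2 ^ (1 : ℝ) :=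
          Real.rpow_le_rpow_of_exponent_le (by norm_num)
            (Real.rpow_le_one_of_one_le_of_nonpos (by linarith) (by linarith))
      _ = 2 := Real.rpow_one 2
  have hcast := tendsto_natCast_atTop_atTop (R := ℝ)
  have hpow := ((tendsto_rpow_atTop hε).comp hcast).eventually_ge_atTop 2
  have hlog := ((Real.tendsto_logb_atTop (b := 2) (by norm_num)).comp hcast).eventually_ge_atTop
    (1 / (1 - ε))
  obtain ⟨r0, h⟩ := Filter.eventually_atTop.1
    ((hpow.and hlog).and (Filter.eventually_ge_atTop 2))
  refine ⟨r0, fun r hr => ?_⟩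
  obtain ⟨⟨hp, hl⟩, hr2⟩ := h r hr
  simp only [Function.comp_apply] at hp hl
  have hr0 : (0 : ℝ) < r := by exact_mod_cast (show 0 < r by omega)
  obtain ⟨q, hq, hq1, hq2⟩ := Nat.exists_prime_lt_and_le_two_mul (r / 2) (by omega)
  have hrq : (r : ℝ) / 2 ≤ q := by
    have : (r : ℝ) ≤ 2 * q := by exact_mod_cast (show r ≤ 2 * q by omega)
    linarith
  set L := Real.logb 2 r with hL
  have hL1 : 1 ≤ (1 - ε) * L := by
    rw [div_le_iff₀ (by linarith)] at hl
    linarith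
  have hL0 : 0 < L := pos_of_mul_pos_right (lt_of_lt_of_le one_pos hL1) (sub_pos.2 h1).le
  have hr2L : (2 : ℝ) ^ L = r := Real.rpow_logb (by norm_num) (by norm_num) hr0
  refine exists_not_hasAltRect_of_prime hq (by omega) (Nat.floor_le_of_le ?_)
    (Nat.floor_le_of_le ?_)
  · push_cast
    rw [← Real.rpow_natCast]
    refine Real.rpow_le_rpow_of_exponent_le (by norm_num) (le_trans ?_ hrq)
    rw [Real.rpow_sub hr0, Real.rpow_one]
    exact div_le_div_of_nonneg_left hr0.le (by norm_num) hp
  · push_cast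
    calc (2 : ℝ) ^ (ε * L ^ 2) ≤ 2 ^ ((L - 1) * L) :=
          Real.rpow_le_rpow_of_exponent_le (by norm_num) (by nlinarith)
      _ = ((r : ℝ) / 2) ^ L := by
          rw [Real.rpow_mul (by norm_num), Real.rpow_sub (by norm_num), hr2L, Real.rpow_one]
      _ ≤ (q : ℝ) ^ L := Real.rpow_le_rpow (by positivity) hrq hL0.le
      _ ≤ (q : ℝ) ^ ((Nat.log 2 r + 1 : ℕ) : ℝ) := by
          refine Real.rpow_le_rpow_of_exponent_le (by exact_mod_cast hq.one_lt.le) ?_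
          rw [hL, Real.logb_le_iff_le_rpow (by norm_num) hr0, Real.rpow_natCast]
          exact_mod_cast (Nat.lt_pow_succ_log_self (by norm_num) r).le
      _ = (q : ℝ) ^ (Nat.log 2 r + 1) := Real.rpow_natCast _ _
end

section
/- With c = e^{−3}, there exists r_0 such that for all integers r ≥ r_0, g(⌊c r²⌋, ⌊r^{r²/2} / e^{r²}⌋) ≤ r; that is, the grid graph Γ_{m,n} with m = ⌊c r²⌋ and n = ⌊r^{r²/2} / e^{r²}⌋ admits an alternating-free edge coloring with r colors. -/
open Finset

open scoped Classical in
/-- A graph all of whose nonempty vertex subsets contain a vertex with fewer than `r` neighbors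
inside the subset is `r`-colorable. -/
theorem SimpleGraph.colorable_of_forall_exists_card_lt {V : Type*} [Fintype V]
    (G : SimpleGraph V) {r : ℕ} (hr : 0 < r)
    (h : ∀ S : Finset V, S.Nonempty → ∃ v ∈ S, #{u ∈ S | G.Adj v u} < r) : G.Colorable r := by
  have key : ∀ S : Finset V, ∃ χ : V → Fin r, ∀ u ∈ S, ∀ v ∈ S, G.Adj u v → χ u ≠ χ v := by
    intro S
    induction S using Finset.strongInduction with
    | H S ih =>
      rcases S.eq_empty_or_nonempty with rfl | hS
      · exact ⟨fun _ => ⟨0, hr⟩, by simp⟩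
      obtain ⟨v, hv, hlt⟩ := h S hS
      obtain ⟨χ, hχ⟩ := ih (S.erase v) (Finset.erase_ssubset hv)
      obtain ⟨a, ha⟩ : ∃ a : Fin r, a ∉ ({u ∈ S | G.Adj v u} : Finset V).image χ := by
        by_contra! hall
        have := Finset.card_le_card (fun a _ => hall a : (univ : Finset (Fin r)) ⊆ _)
        have := this.trans Finset.card_image_le
        rw [Finset.card_univ, Fintype.card_fin] at this
        omega
      simp only [mem_image, mem_filter, not_exists, not_and] at ha
      refine ⟨Function.update χ v a, fun x hx y hy hxy => ?_⟩
      by_cases hxv : x = v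
      · subst hxv
        rw [Function.update_self, Function.update_of_ne hxy.ne']
        exact fun e => ha y ⟨hy, hxy⟩ e.symm
      · by_cases hyv : y = v
        · subst hyv
          rw [Function.update_self, Function.update_of_ne hxv]
          exact ha x ⟨hx, hxy.symm⟩
        · rw [Function.update_of_ne hxv, Function.update_of_ne hyv]
          exact hχ x (by simp [hxv, hx]) y (by simp [hyv, hy]) hxy
  obtain ⟨χ, hχ⟩ := key univ
  exact ⟨SimpleGraph.Coloring.mk χ fun {u v} huv => hχ u (mem_univ _) v (mem_univ _) huv⟩

/-- Chernoff bound for the number of places where a function agrees with a fixed one. -/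
theorem card_agree_mul_exp_le {E : Type*} [Fintype E] [DecidableEq E] {r : ℕ} (hr : 0 < r)
    (g : E → Fin r) (A : Finset E) {s t : ℝ} (hs : 0 ≤ s) :
    (#{f : E → Fin r | t ≤ #{e ∈ A | g e = f e}} : ℝ) * Real.exp (s * t) ≤
      (r : ℝ) ^ Fintype.card E * Real.exp (Real.exp s * #A / r) := by
  have hr' : (0 : ℝ) < r := by exact_mod_cast hr
  let w : E → Fin r → ℝ := fun e c => if e ∈ A ∧ g e = c then Real.exp s else 1
  have hw (f : E → Fin r) : ∏ e, w e (f e) = Real.exp (s * #{e ∈ A | g e = f e}) := by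
    rw [Finset.prod_ite, Finset.prod_const, Finset.prod_const_one, mul_one, ← Real.exp_nat_mul,
      mul_comm]
    congr 4
    ext e
    simp
  have hsum (e : E) :
      ∑ c, w e c ≤ (r : ℝ) * (if e ∈ A then Real.exp (Real.exp s / r) else 1) := by
    by_cases he : e ∈ A
    · have h1 : ∑ c, w e c ≤ r + Real.exp s := by
        calc ∑ c, w e c ≤ ∑ c, (1 + if g e = c then Real.exp s else 0) := by
              refine Finset.sum_le_sum fun c _ => ?_
              by_cases hc : g e = c <;> simp [w, he, hc]
          _ = r + Real.exp s := by simp [Finset.sum_add_distrib]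
      have h2 := Real.add_one_le_exp (Real.exp s / r)
      rw [if_pos he]
      calc _ ≤ r + Real.exp s := h1
        _ = r * (Real.exp s / r + 1) := by field_simp; ring
        _ ≤ _ := by gcongr
    · simp [w, he]
  calc (#{f : E → Fin r | t ≤ #{e ∈ A | g e = f e}} : ℝ) * Real.exp (s * t)
      = ∑ f : E → Fin r with t ≤ #{e ∈ A | g e = f e}, Real.exp (s * t) := by
        rw [Finset.sum_const, nsmul_eq_mul]
    _ ≤ ∑ f : E → Fin r with t ≤ #{e ∈ A | g e = f e}, ∏ e, w e (f e) := by
        refine Finset.sum_le_sum fun f hf => ?_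
        rw [hw]
        have := (Finset.mem_filter.1 hf).2
        gcongr
    _ ≤ ∑ f : E → Fin r, ∏ e, w e (f e) :=
        Finset.sum_le_sum_of_subset_of_nonneg (Finset.filter_subset _ _) fun f _ _ => by
          rw [hw]; positivity
    _ = ∏ e, ∑ c, w e c := by
        rw [Finset.prod_univ_sum, Fintype.piFinset_univ]
    _ ≤ ∏ e, ((r : ℝ) * (if e ∈ A then Real.exp (Real.exp s / r) else 1)) := by
        refine Finset.prod_le_prod (fun e _ => Finset.sum_nonneg fun c _ => ?_) fun e _ => hsum e
        simp only [w]
        split_ifs <;> positivity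
    _ = _ := by
        rw [Finset.prod_mul_distrib, Finset.prod_const, Finset.card_univ, Finset.prod_ite_mem,
          Finset.univ_inter, Finset.prod_const, ← Real.exp_nat_mul]
        congr 2
        ring

/-- Greedy selection: if every element is in conflict with few others, then there are many
elements without conflicts. -/
theorem exists_seq_pairwise_not {α : Type*} [Fintype α] (B : α → α → Prop)
    [∀ x, DecidablePred (B x)] (n : ℕ) (b : ℕ) (hb : ∀ x, #{y | B x y} ≤ b)
    (h : n * b < Fintype.card α) :
    ∃ F : ℕ → α, ∀ i j, i < j → j < n → ¬ B (F i) (F j) := by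
  classical
  induction n with
  | zero =>
    obtain ⟨a⟩ : Nonempty α := Fintype.card_pos_iff.1 (by omega)
    exact ⟨fun _ => a, by simp⟩
  | succ k ih =>
    obtain ⟨F, hF⟩ := ih (lt_of_le_of_lt (Nat.mul_le_mul_right b k.le_succ) h)
    obtain ⟨y, hy⟩ : ∃ y, y ∉ (range k).biUnion fun i => ({y | B (F i) y} : Finset α) := by
      by_contra! hall
      have h1 := Finset.card_le_card (fun a _ => hall a : (univ : Finset α) ⊆ _)
      have h2 := h1.trans (Finset.card_biUnion_le_card_mul _ _ b fun i _ => hb (F i))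
      rw [Finset.card_univ, Finset.card_range] at h2
      have := Nat.mul_le_mul_right b (Nat.le_add_right k 1)
      omega
    simp only [mem_biUnion, mem_range, mem_filter, mem_univ, true_and, not_exists, not_and] at hy
    refine ⟨Function.update F k y, fun i j hij hj => ?_⟩
    rw [Function.update_of_ne (by omega : i ≠ k)]
    rcases Nat.lt_succ_iff_lt_or_eq.1 hj with hj | rfl
    · rw [Function.update_of_ne hj.ne]
      exact hF i j hij hj
    · rw [Function.update_self]
      exact hy i hij

/-- The graph of pairs on which two edge colorings of a complete graph agree. -/
def agreementGraph {V C : Type*} (f g : Sym2 V → C) : SimpleGraph V where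
  Adj u v := u ≠ v ∧ f s(u, v) = g s(u, v)
  symm := ⟨fun u v h => ⟨h.1.symm, by rw [Sym2.eq_swap]; exact h.2⟩⟩
  loopless := ⟨fun _ h => h.1 rfl⟩

/-- If the agreement graph is not `r`-colorable, then some vertex set of size `k > r` contains at
least `k r / 2` of its edges. -/
theorem exists_agree_ge_of_not_colorable {V C : Type*} [Fintype V] [DecidableEq V]
    [DecidableEq C] {r : ℕ} (hr : 0 < r) {f g : Sym2 V → C} (h : ¬ (agreementGraph f g).Colorable r) :
    ∃ S : Finset V, r < #S ∧
      #S * r ≤ 2 * #{e ∈ S.offDiag.image Sym2.mk.uncurry | f e = g e} := by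
  classical
  contrapose! h
  refine SimpleGraph.colorable_of_forall_exists_card_lt _ hr fun S hS => ?_
  by_contra! hdeg
  obtain ⟨v, hv⟩ := hS
  have hcard : r < #S := by
    refine (hdeg v hv).trans_lt (Finset.card_lt_card ?_)
    refine Finset.filter_ssubset.2 ⟨v, hv, fun h => h.1 rfl⟩
  refine (h S hcard).not_ge ?_
  let H : SimpleGraph V := {
    Adj := fun u v => u ∈ S ∧ v ∈ S ∧ (agreementGraph f g).Adj u v
    symm := ⟨fun u v h => ⟨h.2.1, h.1, h.2.2.symm⟩⟩
    loopless := ⟨fun _ h => h.2.2.ne rfl⟩ }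
  have h1 : #S * r ≤ ∑ v, H.degree v := by
    calc #S * r = ∑ v ∈ S, r := by simp
      _ ≤ ∑ v ∈ S, H.degree v := by
        refine Finset.sum_le_sum fun v hv => (hdeg v hv).trans ?_
        rw [← SimpleGraph.card_neighborFinset_eq_degree]
        refine Finset.card_le_card fun u hu => ?_
        rw [Finset.mem_filter] at hu
        rw [SimpleGraph.mem_neighborFinset]
        exact ⟨hv, hu.1, hu.2⟩
      _ ≤ _ := Finset.sum_le_sum_of_subset (Finset.subset_univ _)
  rw [H.sum_degrees_eq_twice_card_edges] at h1
  refine h1.trans (Nat.mul_le_mul_left 2 (Finset.card_le_card fun e he => ?_))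
  induction e with
  | h u v =>
    rw [SimpleGraph.mem_edgeFinset, SimpleGraph.mem_edgeSet] at he
    obtain ⟨hu, hv, hne, heq⟩ := he
    exact Finset.mem_filter.2 ⟨Finset.mem_image.2 ⟨(u, v), by simp [hu, hv, hne], rfl⟩, heq⟩

/-- The numerical estimate behind the union bound: `(e k / r²) ^ (k r / 2) ≤ (e / r) ^ (r² / 2)`
for `r ≤ k ≤ e⁻³ r²`, in logarithmic form. -/
theorem mul_log_sub_le {r k : ℝ} (hr : 0 < r) (hrk : r ≤ k) (hk : k ≤ Real.exp (-3) * r ^ 2) :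
    r ^ 2 / 2 * (Real.log r - 1) ≤ k * r / 2 * (Real.log (r ^ 2 / k) - 1) := by
  have hk0 : 0 < k := hr.trans_le hrk
  have hx : 0 < k / r := by positivity
  have h1 : 1 ≤ k / r := (one_le_div hr).2 hrk
  have hlog : Real.log (r ^ 2 / k) = Real.log r - Real.log (k / r) := by
    rw [Real.log_div (by positivity) hk0.ne', Real.log_div hk0.ne' hr.ne', Real.log_pow]
    push_cast
    ring
  have hL : Real.log (k / r) ≤ Real.log r - 3 := by
    have : k / r ≤ Real.exp (-3) * r := by
      rw [div_le_iff₀ hr]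
      linarith
    have := Real.log_le_log hx this
    rw [Real.log_mul (Real.exp_pos _).ne' hr.ne', Real.log_exp] at this
    linarith
  have hl := Real.log_le_sub_one_of_pos hx
  have hkx : k = k / r * r := by field_simp
  rw [hlog]
  generalize Real.log (k / r) = y at *
  generalize k / r = x at *
  subst hkx
  have : Real.log r - 1 ≤ x * (Real.log r - y - 1) := by nlinarith
  calc _ ≤ r ^ 2 / 2 * (x * (Real.log r - y - 1)) := by gcongr
    _ = _ := by ring

open scoped Classical in
theorem card_not_colorable_le {r m : ℕ} (hr : 0 < r) (hm : (m : ℝ) ≤ Real.exp (-3) * (r : ℝ) ^ 2)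
    (g : Sym2 (Fin m) → Fin r) :
    (#{f : Sym2 (Fin m) → Fin r | ¬ (agreementGraph g f).Colorable r} : ℝ) ≤
      2 ^ m * ((r : ℝ) ^ Fintype.card (Sym2 (Fin m)) *
        Real.exp (-((r : ℝ) ^ 2 / 2 * (Real.log r - 1)))) := by
  have hr' : (0 : ℝ) < r := by exact_mod_cast hr
  let P : Finset (Fin m) → Finset (Sym2 (Fin m)) := fun S => S.offDiag.image Sym2.mk.uncurry
  let bad : Finset (Fin m) → Finset (Sym2 (Fin m) → Fin r) := fun S =>
    {f | ((#S * r / 2 : ℝ)) ≤ #{e ∈ P S | g e = f e}}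
  have hsub : ({f | ¬ (agreementGraph g f).Colorable r} : Finset (Sym2 (Fin m) → Fin r)) ⊆
      ({S | r < #S} : Finset (Finset (Fin m))).biUnion bad := by
    intro f hf
    obtain ⟨S, hS, hle⟩ := exists_agree_ge_of_not_colorable hr (Finset.mem_filter.1 hf).2
    refine Finset.mem_biUnion.2 ⟨S, by simpa using hS, ?_⟩
    simp only [bad, mem_filter, mem_univ, true_and]
    rw [div_le_iff₀ two_pos, mul_comm _ (2 : ℝ)]
    exact_mod_cast hle
  have hbad (S : Finset (Fin m)) (hS : r < #S) :
      (#(bad S) : ℝ) ≤ (r : ℝ) ^ Fintype.card (Sym2 (Fin m)) *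
        Real.exp (-((r : ℝ) ^ 2 / 2 * (Real.log r - 1))) := by
    have hrS : (r : ℝ) ≤ #S := by exact_mod_cast hS.le
    have hS0 : (0 : ℝ) < #S := hr'.trans_le hrS
    have hSm : (#S : ℝ) ≤ Real.exp (-3) * (r : ℝ) ^ 2 := by
      refine le_trans ?_ hm
      exact_mod_cast (Finset.card_le_univ S).trans_eq (Fintype.card_fin m)
    have hP : (#(P S) : ℝ) ≤ (#S : ℝ) ^ 2 / 2 := by
      have : #(P S) = (#S).choose 2 := Sym2.card_image_offDiag S
      rw [this, Nat.cast_choose_two]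
      nlinarith
    have hs : 0 ≤ Real.log ((r : ℝ) ^ 2 / #S) := by
      refine Real.log_nonneg ((one_le_div hS0).2 (hSm.trans ?_))
      have : Real.exp (-3) ≤ 1 := Real.exp_le_one_iff.2 (by norm_num)
      nlinarith [sq_nonneg (r : ℝ)]
    have hch := card_agree_mul_exp_le hr g (P S) (t := #S * r / 2) hs
    rw [← le_div_iff₀ (Real.exp_pos _), mul_div_assoc ((r : ℝ) ^ _), ← Real.exp_sub,
      Real.exp_log (by positivity)] at hch
    refine hch.trans ?_
    gcongr
    have h1 : (r : ℝ) ^ 2 / #S * #(P S) / r ≤ #S * r / 2 := by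
      calc _ ≤ (r : ℝ) ^ 2 / #S * ((#S : ℝ) ^ 2 / 2) / r := by gcongr
        _ = _ := by field_simp
    have h2 := mul_log_sub_le hr' hrS hSm
    linarith
  calc _ ≤ (#(({S | r < #S} : Finset (Finset (Fin m))).biUnion bad) : ℝ) := by
        exact_mod_cast Finset.card_le_card hsub
    _ ≤ ∑ S : Finset (Fin m) with r < #S, (#(bad S) : ℝ) := by
        exact_mod_cast Finset.card_biUnion_le
    _ ≤ ∑ S : Finset (Fin m) with r < #S, ((r : ℝ) ^ Fintype.card (Sym2 (Fin m)) *
        Real.exp (-((r : ℝ) ^ 2 / 2 * (Real.log r - 1)))) :=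
        Finset.sum_le_sum fun S hS => hbad S (Finset.mem_filter.1 hS).2
    _ ≤ ∑ S : Finset (Fin m), ((r : ℝ) ^ Fintype.card (Sym2 (Fin m)) *
        Real.exp (-((r : ℝ) ^ 2 / 2 * (Real.log r - 1)))) :=
        Finset.sum_le_sum_of_subset_of_nonneg (Finset.filter_subset _ _) fun _ _ _ => by positivity
    _ = _ := by simp

/-- Column colorings with pairwise `r`-colorable agreement graphs yield an alternating-free
coloring of the grid graph. -/
theorem exists_not_hasAltRect {m n r : ℕ} (hr : 0 < r) (F : ℕ → Sym2 (Fin m) → Fin r)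
    (hF : ∀ i j, i < j → j < n → (agreementGraph (F i) (F j)).Colorable r) :
    ∃ col : Sym2 (Fin m × Fin n) → Fin r, ¬ HasAltRect col := by
  have hR : ∀ i j : Fin n, ∃ χ : Fin m → Fin r, i < j →
      ∀ u v, (agreementGraph (F i) (F j)).Adj u v → χ u ≠ χ v := by
    intro i j
    by_cases hij : i < j
    · obtain ⟨χ⟩ := hF i j hij j.2
      exact ⟨χ, fun _ u v huv => χ.valid huv⟩
    · exact ⟨fun _ => ⟨0, hr⟩, fun h => absurd h hij⟩
  choose R hR using hR
  refine ⟨fun p => if (p.map Prod.snd).IsDiag then F (p.map Prod.snd).inf (p.map Prod.fst) else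
    R (p.map Prod.snd).inf (p.map Prod.snd).sup (p.map Prod.fst).inf, ?_⟩
  rintro ⟨i, i', j, j', hi, hj, h1, h2⟩
  simp only [Sym2.map_mk, Sym2.mk_isDiag_iff, Sym2.inf_mk, Sym2.sup_mk, hj.ne, if_true,
    if_false, inf_idem, inf_eq_left.2 hj.le, sup_eq_right.2 hj.le] at h1 h2
  exact hR j j' hj i i' ⟨hi.ne, h1⟩ h2

/-- With `c = e^{−3}`, for all sufficiently large `r`, the grid graph `Γ_{m,n}` with
`m = ⌊c r²⌋` and `n = ⌊r^{r²/2} / e^{r²}⌋` admits an alternating-free edge coloring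
with `r` colors, i.e. `g(⌊c r²⌋, ⌊r^{r²/2}/e^{r²}⌋) ≤ r`. -/
theorem grid_ramsey_asymmetric_iii :
    ∃ r0 : ℕ, ∀ r : ℕ, r0 ≤ r →
      ∃ col : Sym2 (Fin (⌊Real.exp (-3) * (r : ℝ) ^ 2⌋₊) ×
          Fin (⌊(r : ℝ) ^ ((r : ℝ) ^ 2 / 2) / Real.exp ((r : ℝ) ^ 2)⌋₊)) → Fin r,
        ¬ HasAltRect col := by
  classical
  refine ⟨1, fun r hr => ?_⟩
  have hr' : (0 : ℝ) < r := by exact_mod_cast hr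
  have hm := Nat.floor_le (by positivity : 0 ≤ Real.exp (-3) * (r : ℝ) ^ 2)
  have hn := Nat.floor_le
    (by positivity : 0 ≤ (r : ℝ) ^ ((r : ℝ) ^ 2 / 2) / Real.exp ((r : ℝ) ^ 2))
  set m := ⌊Real.exp (-3) * (r : ℝ) ^ 2⌋₊
  set n := ⌊(r : ℝ) ^ ((r : ℝ) ^ 2 / 2) / Real.exp ((r : ℝ) ^ 2)⌋₊
  rw [Real.rpow_def_of_pos hr', ← Real.exp_sub] at hn
  have h2m : (2 : ℝ) ^ m ≤ Real.exp ((r : ℝ) ^ 2 / 4) := by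
    have he : Real.exp (-3) ≤ 1 / 4 := by
      rw [Real.exp_neg, one_div]
      exact inv_anti₀ (by norm_num) (by linarith [Real.add_one_le_exp (3 : ℝ)])
    have h2 : (2 : ℝ) ≤ Real.exp 1 := by linarith [Real.add_one_le_exp (1 : ℝ)]
    calc (2 : ℝ) ^ m ≤ Real.exp 1 ^ m := by gcongr
      _ = Real.exp m := by rw [← Real.exp_nat_mul, mul_one]
      _ ≤ _ := by
        gcongr
        nlinarith [sq_nonneg (r : ℝ)]
  let b : ℕ := ⌊(2 : ℝ) ^ m * ((r : ℝ) ^ Fintype.card (Sym2 (Fin m)) *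
    Real.exp (-((r : ℝ) ^ 2 / 2 * (Real.log r - 1))))⌋₊
  have hlt : n * b < Fintype.card (Sym2 (Fin m) → Fin r) := by
    rw [Fintype.card_fun, Fintype.card_fin, ← Nat.cast_lt (α := ℝ)]
    push_cast
    have hb : (b : ℝ) ≤ _ := Nat.floor_le (by positivity)
    calc (n : ℝ) * b ≤ Real.exp (Real.log r * ((r : ℝ) ^ 2 / 2) - (r : ℝ) ^ 2) *
          (Real.exp ((r : ℝ) ^ 2 / 4) * ((r : ℝ) ^ Fintype.card (Sym2 (Fin m)) *
            Real.exp (-((r : ℝ) ^ 2 / 2 * (Real.log r - 1))))) := by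
          gcongr
          refine hb.trans ?_
          gcongr
      _ = (r : ℝ) ^ Fintype.card (Sym2 (Fin m)) * Real.exp (-((r : ℝ) ^ 2 / 4)) := by
          rw [mul_left_comm (Real.exp ((r : ℝ) ^ 2 / 4)), mul_left_comm, ← Real.exp_add,
            ← Real.exp_add]
          ring_nf
      _ < (r : ℝ) ^ Fintype.card (Sym2 (Fin m)) * 1 := by
          gcongr
          rw [Real.exp_lt_one_iff]
          have : 0 < (r : ℝ) ^ 2 := by positivity
          linarith
      _ = _ := mul_one _
  obtain ⟨F, hF⟩ := exists_seq_pairwise_not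
    (fun g f : Sym2 (Fin m) → Fin r => ¬ (agreementGraph g f).Colorable r) n b
    (fun g => Nat.le_floor (card_not_colorable_le hr hm g)) hlt
  exact exists_not_hasAltRect hr F fun i j hij hj => not_not.1 (hF i j hij hj)
end

section
/- Let r, k, p, q be integers, all greater than 1, satisfying r ≥ k, p ≥ k+1 and 2 ≤ q ≤ C(p,k). Then F_k(r, p, q) ≤ r^{C(N, k−1)}, where N = F_{k−1}(r, p−1, q) if q ≤ C(p−1, k−1), and N = p−1 if q > C(p−1, k−1). That is, every coloring of the k-element subsets of a set of r^{C(N,k−1)} vertices with r colors contains a set of p vertices on which at most q−1 distinct colors appear. -/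
/-- `Fk k r p q` is the generalized Ramsey number `F_k(r,p,q)`: the minimum `n`
such that every coloring of the `k`-element subsets of an `n`-element set with
`r` colors contains a set of `p` vertices on whose `k`-subsets at most `q − 1`
distinct colors appear. -/
noncomputable def Fk (k r p q : ℕ) : ℕ :=
  sInf {n : ℕ | ∀ c : Finset (Fin n) → Fin r,
    ∃ P : Finset (Fin n), P.card = p ∧ ((P.powersetCard k).image c).card ≤ q - 1}

/-- Every element of `A` precedes every element of `S`, and the color of a set `insert s B`,
where `B` is an `(m + 1)`-subset of `A` and `s ∈ A ∪ S` lies above `B`, depends only on `B`. -/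
def EndHomogeneous {α β : Type*} [LinearOrder α] (m : ℕ) (c : Finset α → β)
    (A S : Finset α) : Prop :=
  (∀ a ∈ A, ∀ s ∈ S, a < s) ∧
    ∀ B ∈ A.powersetCard (m + 1), ∀ s ∈ A ∪ S, ∀ s' ∈ A ∪ S,
      (∀ b ∈ B, b < s) → (∀ b ∈ B, b < s') → c (insert s B) = c (insert s' B)

/-- If `|A| = i` and the reservoir `S` has more than `reservoirBound r m i j` elements, then an
end-homogeneous pair `(A, S)` can be extended by `j` more vertices without exhausting `S`. -/
def reservoirBound (r m : ℕ) : ℕ → ℕ → ℕ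
  | _, 0 => 0
  | i, j + 1 => reservoirBound r m (i + 1) j * r ^ i.choose m + 1

theorem EndHomogeneous.exists_insert {α : Type*} [LinearOrder α] {r m t : ℕ}
    {c : Finset α → Fin r} {A S : Finset α} (h : EndHomogeneous m c A S)
    (hS : t * r ^ A.card.choose m + 1 < S.card) :
    ∃ x ∉ A, ∃ S' : Finset α, t < S'.card ∧ EndHomogeneous m c (insert x A) S' := by
  classical
  obtain ⟨hlt, hc⟩ := h
  have hne : S.Nonempty := Finset.card_pos.mp (by omega)
  set x := S.min' hne
  have hx : x ∈ S := S.min'_mem hne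
  have hxA : x ∉ A := fun hxA => lt_irrefl _ (hlt x hxA x hx)
  let f : α → (A.powersetCard m → Fin r) := fun s B => c (insert s (insert x B.1))
  have hcard : (Finset.univ : Finset (A.powersetCard m → Fin r)).card * t
      < (S.erase x).card := by
    rw [Finset.card_erase_of_mem hx, Finset.card_univ, Fintype.card_fun, Fintype.card_fin,
      Fintype.card_coe, Finset.card_powersetCard, mul_comm]
    omega
  obtain ⟨y, -, hy⟩ := Finset.exists_lt_card_fiber_of_mul_lt_card_of_maps_to
    (f := f) (fun _ _ => Finset.mem_univ _) hcard
  refine ⟨x, hxA, (S.erase x).filter (fun s => f s = y), hy, ?_, ?_⟩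
  · intro a ha s hs
    obtain ⟨hs, -⟩ := Finset.mem_filter.mp hs
    obtain ⟨hsx, hs⟩ := Finset.mem_erase.mp hs
    rcases Finset.mem_insert.mp ha with rfl | ha
    · exact lt_of_le_of_ne (S.min'_le s hs) (Ne.symm hsx)
    · exact hlt a ha s hs
  · intro B hB s hs s' hs' hBs hBs'
    obtain ⟨hBA, hBcard⟩ := Finset.mem_powersetCard.mp hB
    by_cases hxB : x ∈ B
    · have key : ∀ u ∈ insert x A ∪ (S.erase x).filter (fun s => f s = y),
          (∀ b ∈ B, b < u) → f u = y := by
        intro u hu hBu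
        rcases Finset.mem_union.mp hu with hu | hu
        · rcases Finset.mem_insert.mp hu with hu | hu
          · exact absurd (hBu x hxB) (by simp [hu])
          · exact absurd (hBu x hxB) (lt_asymm (hlt u hu x hx))
        · exact (Finset.mem_filter.mp hu).2
      have hB₀ : B.erase x ∈ A.powersetCard m := by
        rw [Finset.mem_powersetCard, Finset.card_erase_of_mem hxB, hBcard]
        exact ⟨Finset.subset_insert_iff.mp hBA, rfl⟩
      have := congrFun ((key s hs hBs).trans (key s' hs' hBs').symm) ⟨B.erase x, hB₀⟩
      simpa only [f, Finset.insert_erase hxB] using this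
    · have hsub : insert x A ∪ (S.erase x).filter (fun s => f s = y) ⊆ A ∪ S := by
        intro u hu
        simp only [Finset.mem_union, Finset.mem_insert, Finset.mem_filter,
          Finset.mem_erase] at hu ⊢
        rcases hu with (rfl | hu) | hu
        · exact Or.inr hx
        · exact Or.inl hu
        · exact Or.inr hu.1.2
      exact hc B (Finset.mem_powersetCard.mpr
        ⟨(Finset.subset_insert_iff_of_notMem hxB).mp hBA, hBcard⟩)
        s (hsub hs) s' (hsub hs') hBs hBs'

theorem EndHomogeneous.exists_extension {α : Type*} [LinearOrder α] {r m : ℕ}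
    {c : Finset α → Fin r} (j : ℕ) {A S : Finset α} (h : EndHomogeneous m c A S)
    (hS : reservoirBound r m A.card j < S.card) :
    ∃ A' S' : Finset α, A'.card = A.card + j ∧ S'.Nonempty ∧ EndHomogeneous m c A' S' := by
  induction j generalizing A S with
  | zero => exact ⟨A, S, rfl, Finset.card_pos.mp (by omega), h⟩
  | succ j ih =>
    obtain ⟨x, hx, S', hS', h'⟩ := h.exists_insert hS
    have hcard := Finset.card_insert_of_notMem hx
    obtain ⟨A', T, hA', hne, hT⟩ := ih h' (by rwa [hcard])
    exact ⟨A', T, by omega, hne, hT⟩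

/-- Stepping down: a coloring `c` of `(m + 2)`-sets on sufficiently many vertices induces a
coloring `g` of the `(m + 1)`-subsets of `Fin N` such that each `P` gives rise to a set `Q` with one
more vertex, all of whose colors appear on `P`. -/
theorem exists_step_down {r m N n : ℕ} (hn : reservoirBound r m 0 N < n)
    (c : Finset (Fin n) → Fin r) :
    ∃ g : Finset (Fin N) → Fin r, ∀ P : Finset (Fin N), ∃ Q : Finset (Fin n),
      Q.card = P.card + 1 ∧
        (Q.powersetCard (m + 2)).image c ⊆ (P.powersetCard (m + 1)).image g := by
  have h₀ : EndHomogeneous m c ∅ Finset.univ :=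
    ⟨by simp, fun B hB => by
      obtain ⟨rfl, h⟩ : B = ∅ ∧ B.card = m + 1 := by simpa using hB
      simp at h⟩
  obtain ⟨A, S, hA, ⟨z, hz⟩, hlt, hc⟩ := h₀.exists_extension N (by simpa using hn)
  have hAN : A.card = N := by simpa using hA
  let e : Fin N ↪ Fin n := (A.orderEmbOfFin hAN).toEmbedding
  have heA : ∀ P : Finset (Fin N), P.map e ⊆ A := by
    intro P u hu
    obtain ⟨v, -, rfl⟩ := Finset.mem_map.mp hu
    exact A.orderEmbOfFin_mem hAN v
  refine ⟨fun B => c (insert z (B.map e)), fun P => ⟨insert z (P.map e), ?_, ?_⟩⟩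
  · rw [Finset.card_insert_of_notMem, Finset.card_map]
    exact fun h => lt_irrefl _ (hlt z (heA P h) z hz)
  · intro d hd
    obtain ⟨K, hK, rfl⟩ := Finset.mem_image.mp hd
    obtain ⟨hKP, hKcard⟩ := Finset.mem_powersetCard.mp hK
    have hne : K.Nonempty := Finset.card_pos.mp (by omega)
    set s := K.max' hne
    have hs : s ∈ K := K.max'_mem hne
    have hBs : ∀ b ∈ K.erase s, b < s := fun b hb => K.lt_max'_of_mem_erase_max' hne hb
    have hBP : K.erase s ⊆ P.map e := by
      intro b hb
      rcases Finset.mem_insert.mp (hKP (Finset.mem_of_mem_erase hb)) with rfl | h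
      · rcases Finset.mem_insert.mp (hKP hs) with hsz | h
        · exact absurd (hBs b hb) (by simp [hsz])
        · exact absurd (hBs b hb) (lt_asymm (hlt s (heA P h) b hz))
      · exact h
    have hBcard : (K.erase s).card = m + 1 := by
      rw [Finset.card_erase_of_mem hs, hKcard]; rfl
    have hsAS : s ∈ A ∪ S := by
      rcases Finset.mem_insert.mp (hKP hs) with hsz | h
      · exact Finset.mem_union_right _ (hsz ▸ hz)
      · exact Finset.mem_union_left _ (heA P h)
    have hcol := hc (K.erase s)
      (Finset.mem_powersetCard.mpr ⟨hBP.trans (heA P), hBcard⟩) s hsAS z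
      (Finset.mem_union_right _ hz) hBs (fun b hb => hlt b (heA P (hBP hb)) z hz)
    rw [Finset.insert_erase hs] at hcol
    obtain ⟨B, hB, hBe⟩ := Finset.subset_map_iff.mp hBP
    refine Finset.mem_image.mpr ⟨B, Finset.mem_powersetCard.mpr ⟨hB, ?_⟩, ?_⟩
    · rw [← Finset.card_map e, ← hBe, hBcard]
    · rw [hcol, hBe]

/-- Ramsey's theorem for hypergraphs of uniformity `k + 1` and `r` colors. -/
theorem exists_ramsey (k r p : ℕ) :
    ∃ n : ℕ, ∀ c : Finset (Fin n) → Fin r, ∃ P : Finset (Fin n),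
      P.card = p ∧ ((P.powersetCard (k + 1)).image c).card ≤ 1 := by
  induction k generalizing p with
  | zero =>
    refine ⟨r * p + 1, fun c => ?_⟩
    obtain ⟨d, -, hd⟩ := Finset.exists_lt_card_fiber_of_mul_lt_card_of_maps_to
      (s := (Finset.univ : Finset (Fin (r * p + 1)))) (t := (Finset.univ : Finset (Fin r)))
      (n := p) (f := fun v => c {v}) (fun _ _ => Finset.mem_univ _) (by simp)
    obtain ⟨P, hP, hPcard⟩ := Finset.exists_subset_card_eq hd.le
    refine ⟨P, hPcard, (Finset.card_le_card (t := {d}) ?_).trans (Finset.card_singleton d).le⟩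
    intro x hx
    obtain ⟨K, hK, rfl⟩ := Finset.mem_image.mp hx
    obtain ⟨hKP, hKcard⟩ := Finset.mem_powersetCard.mp hK
    obtain ⟨v, rfl⟩ := Finset.card_eq_one.mp hKcard
    simpa using hP (Finset.singleton_subset_iff.mp hKP)
  | succ k ih =>
    obtain ⟨N, hN⟩ := ih p
    refine ⟨reservoirBound r k 0 N + 1, fun c => ?_⟩
    obtain ⟨g, hg⟩ := exists_step_down (Nat.lt_succ_self _) c
    obtain ⟨P, hP, hPg⟩ := hN g
    obtain ⟨Q, hQ, hQc⟩ := hg P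
    obtain ⟨Q', hQ', hcard⟩ := Finset.exists_subset_card_eq (show p ≤ Q.card by omega)
    refine ⟨Q', hcard, (Finset.card_le_card ?_).trans hPg⟩
    exact (Finset.image_subset_image (Finset.powersetCard_mono hQ')).trans hQc

theorem Fk_spec (k r p q : ℕ) (hk : 1 ≤ k) (hq : 2 ≤ q) :
    ∀ c : Finset (Fin (Fk k r p q)) → Fin r, ∃ P : Finset (Fin (Fk k r p q)),
      P.card = p ∧ ((P.powersetCard k).image c).card ≤ q - 1 := by
  obtain ⟨k, rfl⟩ := Nat.exists_eq_add_of_le' hk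
  obtain ⟨n, hn⟩ := exists_ramsey k r p
  refine Nat.sInf_mem (s := {n : ℕ | ∀ c : Finset (Fin n) → Fin r,
    ∃ P : Finset (Fin n), P.card = p ∧ ((P.powersetCard (k + 1)).image c).card ≤ q - 1})
    ⟨n, fun c => ?_⟩
  obtain ⟨P, hP, hPc⟩ := hn c
  exact ⟨P, hP, by omega⟩

theorem reservoirBound_add (r m j : ℕ) {i l : ℕ} (h : i + l = m) :
    reservoirBound r m i (l + j) = l + reservoirBound r m m j := by
  induction l generalizing i with
  | zero => simp_all
  | succ l ih =>
    rw [show l + 1 + j = l + j + 1 by ring, reservoirBound, ih (by omega),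
      Nat.choose_eq_zero_of_lt (by omega)]
    ring

theorem reservoirBound_succ_mul_lt {r m i : ℕ} (j : ℕ) (hi : m ≤ i) :
    reservoirBound (r + 1) m i (j + 1) * r + 1 ≤
      (r + 1) ^ (∑ l ∈ Finset.range j, (i + l).choose m + 1) := by
  induction j generalizing i with
  | zero => simp [reservoirBound]
  | succ j ih =>
    rw [reservoirBound, Finset.sum_range_succ']
    have h := ih (i := i + 1) (by omega)
    have hsum : ∑ l ∈ Finset.range j, (i + (l + 1)).choose m
        = ∑ l ∈ Finset.range j, (i + 1 + l).choose m :=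
      Finset.sum_congr rfl fun l _ => by rw [add_assoc, add_comm l 1]
    have hc : r + 1 ≤ (r + 1) ^ i.choose m :=
      Nat.le_self_pow (Nat.choose_pos hi).ne' _
    rw [hsum, add_zero, add_right_comm, pow_add _ (_ + 1)]
    generalize (r + 1) ^ i.choose m = C at *
    nlinarith [Nat.mul_le_mul_right C h]

theorem sum_range_choose_add (m j : ℕ) :
    ∑ l ∈ Finset.range j, (m + l).choose m = (m + j).choose (m + 1) := by
  induction j with
  | zero => simp
  | succ j ih => rw [Finset.sum_range_succ, ih, ← add_assoc, Nat.choose_succ_succ, add_comm]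

theorem reservoirBound_lt_pow {r m N : ℕ} (hr : m + 2 ≤ r) (hN : m + 2 ≤ N) :
    reservoirBound r m 0 N < r ^ N.choose (m + 1) := by
  obtain ⟨j, rfl⟩ := Nat.exists_eq_add_of_le hN
  obtain ⟨r, rfl⟩ := Nat.exists_eq_add_of_le' (show 1 ≤ r by omega)
  rw [show m + 2 + j = m + (j + 1 + 1) by ring, reservoirBound_add r.succ m _ (zero_add m)]
  have h := reservoirBound_succ_mul_lt (r := r) (j + 1) (le_refl m)
  rw [sum_range_choose_add] at h
  have hle : (m + (j + 1)).choose (m + 1) + 1 ≤ (m + (j + 1 + 1)).choose (m + 1) := by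
    rw [← add_assoc m (j + 1) 1, Nat.choose_succ_succ, add_comm]
    exact Nat.add_le_add_right (Nat.choose_pos (by omega)) _
  refine lt_of_lt_of_le ?_ (Nat.pow_le_pow_right (by omega) hle)
  have hy : r + 1 ≤ (r + 1) ^ ((m + (j + 1)).choose (m + 1) + 1) :=
    Nat.le_self_pow (by omega) _
  generalize (r + 1) ^ ((m + (j + 1)).choose (m + 1) + 1) = y at *
  generalize reservoirBound (r + 1) m m (j + 1 + 1) = t at *
  obtain ⟨r, rfl⟩ := Nat.exists_eq_add_of_le' (show 1 ≤ r by omega)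
  by_contra! hlt
  have : y ≤ t + r := by omega
  nlinarith

/-- Theorem 3 (step-down bound): for `r, k, p, q > 1` with `r ≥ k`, `p ≥ k+1` and
`2 ≤ q ≤ C(p,k)`, we have `F_k(r,p,q) ≤ r^{C(N,k−1)}` where `N = F_{k−1}(r,p−1,q)`
if `q ≤ C(p−1,k−1)` and `N = p−1` otherwise; that is, every `r`-coloring of the
`k`-subsets of a set of `r^{C(N,k−1)}` vertices contains `p` vertices spanning at
most `q−1` colors. -/
theorem step_down_bound (r k p q : ℕ) (hr : 1 < r) (hk : 1 < k) (hp : 1 < p)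
    (hq : 1 < q) (hrk : k ≤ r) (hpk : k + 1 ≤ p) (hqp : q ≤ p.choose k) :
    ∀ c : Finset (Fin (r ^ Nat.choose
        (if q ≤ (p - 1).choose (k - 1) then Fk (k - 1) r (p - 1) q else p - 1)
        (k - 1))) → Fin r,
      ∃ P : Finset (Fin (r ^ Nat.choose
        (if q ≤ (p - 1).choose (k - 1) then Fk (k - 1) r (p - 1) q else p - 1)
        (k - 1))),
        P.card = p ∧ ((P.powersetCard k).image c).card ≤ q - 1 := by
  obtain ⟨m, rfl⟩ := Nat.exists_eq_add_of_le' (show 2 ≤ k from hk)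
  set N := if q ≤ (p - 1).choose (m + 2 - 1) then Fk (m + 2 - 1) r (p - 1) q else p - 1 with hNdef
  have hN : ∀ g : Finset (Fin N) → Fin r, ∃ P : Finset (Fin N),
      P.card = p - 1 ∧ ((P.powersetCard (m + 1)).image g).card ≤ q - 1 := by
    split_ifs at hNdef with hcase
    · rw [hNdef]
      exact Fk_spec (m + 1) r (p - 1) q (by omega) hq
    · intro g
      refine ⟨Finset.univ, by simp [hNdef], Finset.card_image_le.trans ?_⟩
      rw [Finset.card_powersetCard, Finset.card_univ, Fintype.card_fin, hNdef]
      exact Nat.le_sub_one_of_lt (not_le.mp hcase)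
  have hpN : p - 1 ≤ N := by
    obtain ⟨P, hP, -⟩ := hN fun _ => ⟨0, by omega⟩
    simpa [hP] using P.card_le_univ
  intro c
  obtain ⟨g, hg⟩ := exists_step_down (reservoirBound_lt_pow hrk (by omega)) c
  obtain ⟨P, hP, hPg⟩ := hN g
  obtain ⟨Q, hQ, hQc⟩ := hg P
  exact ⟨Q, by omega, (Finset.card_le_card hQc).trans hPg⟩
end

section
/- There exists a positive constant c such that for all positive integers r, F_3(r, 5, 6) ≥ 2^{c (log r)²}; equivalently, for n < 2^{c (log r)²} there exists a coloring of the 3-element subsets of an n-element set with r colors in which every 5 vertices span at least 6 distinct colors. -/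
/-- The smallest of the weights `a, b, c, d` of the unit intervals between `i` and `j`. -/
def chainMin (a b c d : ℕ) : ℕ → ℕ → ℕ
  | 0, 1 => a
  | 0, 2 => min a b
  | 0, 3 => min a (min b c)
  | 0, 4 => min a (min b (min c d))
  | 1, 2 => b
  | 1, 3 => min b c
  | 1, 4 => min b (min c d)
  | 2, 3 => c
  | 2, 4 => min c d
  | 3, 4 => d
  | _, _ => a

/-- Whether `i` and `j` are distinct and are separated at depth `e`. -/
def splitAt (M : ℕ → ℕ → ℕ) (e : ℕ) (i j : Fin 5) : Bool :=
  (i.val != j.val) && (M (min i.val j.val) (max i.val j.val) == e)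

/-- A sufficient condition, in terms of the separation depths `M`, for two triples to receive
different colors. -/
def separated (M : ℕ → ℕ → ℕ) (T S : Fin 5 × Fin 5 × Fin 5) : Bool :=
  (M T.1 T.2.1 != M S.1 S.2.1) || (M T.2.1 T.2.2 != M S.2.1 S.2.2) ||
  splitAt M (M T.1 T.2.1) T.1 S.1 || splitAt M (M T.1 T.2.1) T.2.1 S.2.1 ||
  splitAt M (M T.1 T.2.1) T.2.2 S.2.2 || splitAt M (M T.2.1 T.2.2) T.1 S.1 ||
  splitAt M (M T.2.1 T.2.2) T.2.1 S.2.1 || splitAt M (M T.2.1 T.2.2) T.2.2 S.2.2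

/-- Whether `c` can be extended to a clique of `adj` by all but at most `n` elements of the list. -/
def cliqueExtends {α : Type*} (adj : α → α → Bool) : ℕ → List α → List α → Bool
  | _, _, [] => true
  | 0, c, a :: l => c.all (fun x => adj x a) && cliqueExtends adj 0 (a :: c) l
  | n + 1, c, a :: l =>
    (c.all (fun x => adj x a) && cliqueExtends adj (n + 1) (a :: c) l) || cliqueExtends adj n c l

/-- The increasing triples of `Fin 5`. -/
def triples : List (Fin 5 × Fin 5 × Fin 5) :=
  [(0, 1, 2), (0, 1, 3), (0, 1, 4), (0, 2, 3), (0, 2, 4), (0, 3, 4), (1, 2, 3), (1, 2, 4),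
    (1, 3, 4), (2, 3, 4)]

/-- The increasing quadruples of `Fin 5`. -/
def quadruples : List (Fin 5 × Fin 5 × Fin 5 × Fin 5) :=
  [(0, 1, 3, 4), (1, 2, 3, 4), (0, 1, 2, 3), (0, 1, 2, 4), (0, 2, 3, 4)]

theorem lt_of_mem_triples : ∀ T ∈ triples, T.1 < T.2.1 ∧ T.2.1 < T.2.2 := by
  decide +kernel

theorem lt_of_mem_quadruples : ∀ Q ∈ quadruples, Q.1 < Q.2.1 ∧ Q.2.2.1 < Q.2.2.2 := by
  decide +kernel

/-- Whether a clique of six triples exists, however one of the pairs `pqs, pqu` and `psu, qsu` is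
made adjacent for each of the listed quadruples `pqsu`. -/
def forcedClique (adj : Fin 5 × Fin 5 × Fin 5 → Fin 5 × Fin 5 × Fin 5 → Bool) :
    List (Fin 5 × Fin 5 × Fin 5 × Fin 5) → Bool
  | [] => cliqueExtends adj 4 [] triples
  | (p, q, s, u) :: l =>
    cliqueExtends adj 4 [] triples ||
      (forcedClique (fun T S => adj T S || (T == (p, q, s) && S == (p, q, u))) l &&
        forcedClique (fun T S => adj T S || (T == (p, s, u) && S == (q, s, u))) l)

/-- Whether each of `a, b, c, d` equals the number of strictly smaller entries. -/
def isRankVector (a b c d : ℕ) : Bool :=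
  [a, b, c, d].all fun x => x == [a, b, c, d].countP fun y => y < x

theorem forcedClique_of_isRankVector :
    ((List.range 4).all fun a => (List.range 4).all fun b => (List.range 4).all fun c =>
      (List.range 4).all fun d =>
        !isRankVector a b c d || forcedClique (separated (chainMin a b c d)) quadruples) = true := by
  decide +kernel

theorem exists_nodup_of_cliqueExtends {α β : Type*} {adj : α → α → Bool} {f : α → β} {s : List α}
    (hf : ∀ a ∈ s, ∀ b ∈ s, adj a b = true → f a ≠ f b) (n : ℕ) (c l : List α)
    (hc : c ⊆ s) (hl : l ⊆ s) (hnd : (c.map f).Nodup) (h : cliqueExtends adj n c l = true) :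
    ∃ c' ⊆ s, (c'.map f).Nodup ∧ c.length + l.length ≤ c'.length + n := by
  induction l generalizing n c with
  | nil => exact ⟨c, hc, hnd, by simp⟩
  | cons a l ih =>
    have has : a ∈ s := hl (by simp)
    have hls : l ⊆ s := fun x hx => hl (by simp [hx])
    have take (m : ℕ) (hall : c.all (fun x => adj x a) = true)
        (hm : cliqueExtends adj m (a :: c) l = true) :
        ∃ c' ⊆ s, (c'.map f).Nodup ∧ c.length + (a :: l).length ≤ c'.length + m := by
      obtain ⟨c', hs, hn, hlen⟩ := ih m (a :: c) (by simp [has, hc]) hls (by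
        simp only [List.map_cons, List.nodup_cons, List.mem_map, not_exists, not_and]
        refine ⟨fun x hx => ?_, hnd⟩
        exact hf x (hc hx) a has (List.all_eq_true.1 hall x hx)) hm
      exact ⟨c', hs, hn, by simp only [List.length_cons] at hlen ⊢; omega⟩
    cases n with
    | zero =>
      simp only [cliqueExtends, Bool.and_eq_true] at h
      exact take 0 h.1 h.2
    | succ n =>
      simp only [cliqueExtends, Bool.or_eq_true, Bool.and_eq_true] at h
      rcases h with h | h
      · exact take (n + 1) h.1 h.2
      · obtain ⟨c', hs, hn, hlen⟩ := ih n c hc hls hnd h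
        exact ⟨c', hs, hn, by simp only [List.length_cons]; omega⟩

theorem six_le_card_of_cliqueExtends {β : Type*} [DecidableEq β]
    {adj : Fin 5 × Fin 5 × Fin 5 → Fin 5 × Fin 5 × Fin 5 → Bool} {f : Fin 5 × Fin 5 × Fin 5 → β}
    (hf : ∀ T ∈ triples, ∀ S ∈ triples, adj T S = true → f T ≠ f S)
    (h : cliqueExtends adj 4 [] triples = true) : 6 ≤ (triples.toFinset.image f).card := by
  obtain ⟨c, hs, hn, hlen⟩ :=
    exists_nodup_of_cliqueExtends hf 4 [] triples (by simp) (by simp) (by simp) h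
  have hsub : (c.map f).toFinset ⊆ triples.toFinset.image f := by
    intro y hy
    simp only [List.mem_toFinset, List.mem_map, Finset.mem_image] at hy ⊢
    obtain ⟨T, hT, rfl⟩ := hy
    exact ⟨T, hs hT, rfl⟩
  have hcard := Finset.card_le_card hsub
  rw [List.toFinset_card_of_nodup hn, List.length_map] at hcard
  have : triples.length = 10 := rfl
  simp only [List.length_nil] at hlen
  omega

theorem six_le_card_of_forcedClique {β : Type*} [DecidableEq β] {f : Fin 5 × Fin 5 × Fin 5 → β}
    (l : List (Fin 5 × Fin 5 × Fin 5 × Fin 5))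
    (hl : ∀ Q ∈ l, f (Q.1, Q.2.1, Q.2.2.1) ≠ f (Q.1, Q.2.1, Q.2.2.2) ∨
      f (Q.1, Q.2.2.1, Q.2.2.2) ≠ f (Q.2.1, Q.2.2.1, Q.2.2.2))
    (adj : Fin 5 × Fin 5 × Fin 5 → Fin 5 × Fin 5 × Fin 5 → Bool)
    (hf : ∀ T ∈ triples, ∀ S ∈ triples, adj T S = true → f T ≠ f S)
    (h : forcedClique adj l = true) : 6 ≤ (triples.toFinset.image f).card := by
  induction l generalizing adj with
  | nil => exact six_le_card_of_cliqueExtends hf h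
  | cons Q l ih =>
    obtain ⟨p, q, s, u⟩ := Q
    simp only [forcedClique, Bool.or_eq_true, Bool.and_eq_true] at h
    rcases h with h | ⟨h₁, h₂⟩
    · exact six_le_card_of_cliqueExtends hf h
    · have hl' := fun Q hQ => hl Q (List.mem_cons_of_mem _ hQ)
      rcases hl (p, q, s, u) (by simp) with hne | hne
      · refine ih hl' _ (fun T hT S hS hTS => ?_) h₁
        simp only [Bool.or_eq_true, Bool.and_eq_true, beq_iff_eq] at hTS
        rcases hTS with hTS | ⟨rfl, rfl⟩
        exacts [hf T hT S hS hTS, hne]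
      · refine ih hl' _ (fun T hT S hS hTS => ?_) h₂
        simp only [Bool.or_eq_true, Bool.and_eq_true, beq_iff_eq] at hTS
        rcases hTS with hTS | ⟨rfl, rfl⟩
        exacts [hf T hT S hS hTS, hne]

theorem separated_comp {M : ℕ → ℕ → ℕ} {ρ : ℕ → ℕ}
    (hρ : ∀ i j k l, ρ (M i j) = ρ (M k l) ↔ M i j = M k l) (T S : Fin 5 × Fin 5 × Fin 5) :
    separated (fun i j => ρ (M i j)) T S = separated M T S := by
  rw [Bool.eq_iff_iff]
  simp [separated, splitAt, hρ]

theorem chainMin_comp {ρ : ℕ → ℕ} (hρ : Monotone ρ) (a b c d : ℕ) :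
    chainMin (ρ a) (ρ b) (ρ c) (ρ d) = fun i j => ρ (chainMin a b c d i j) := by
  funext i j
  unfold chainMin
  split <;> simp [hρ.map_min]

theorem chainMin_mem (a b c d i j : ℕ) : chainMin a b c d i j ∈ [a, b, c, d] := by
  unfold chainMin
  split <;> grind

theorem six_le_card_of_separated {β : Type*} [DecidableEq β] {f : Fin 5 × Fin 5 × Fin 5 → β}
    (a b c d : ℕ)
    (hsep : ∀ T ∈ triples, ∀ S ∈ triples, separated (chainMin a b c d) T S = true → f T ≠ f S)
    (hgrid : ∀ Q ∈ quadruples, f (Q.1, Q.2.1, Q.2.2.1) ≠ f (Q.1, Q.2.1, Q.2.2.2) ∨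
      f (Q.1, Q.2.2.1, Q.2.2.2) ≠ f (Q.2.1, Q.2.2.1, Q.2.2.2)) :
    6 ≤ (triples.toFinset.image f).card := by
  let ρ : ℕ → ℕ := fun x => [a, b, c, d].countP fun y => y < x
  have hmono : Monotone ρ := fun x y hxy => List.countP_mono_left fun z _ hz => by
    simp only [decide_eq_true_eq] at hz ⊢
    omega
  have hstrict : ∀ x ∈ [a, b, c, d], ∀ y, x < y → ρ x < ρ y := by
    intro x hx y hxy
    simp only [List.mem_cons, List.not_mem_nil, or_false] at hx
    simp only [ρ, List.countP_cons, List.countP_nil, decide_eq_true_eq]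
    rcases hx with rfl | rfl | rfl | rfl <;> split_ifs <;> omega
  have hlt : ∀ x ∈ [a, b, c, d], ∀ y, ρ x < ρ y ↔ x < y := fun x hx y =>
    ⟨fun h => hmono.reflect_lt h, hstrict x hx y⟩
  have hinj : ∀ x ∈ [a, b, c, d], ∀ y ∈ [a, b, c, d], ρ x = ρ y ↔ x = y := by
    intro x hx y hy
    have h₁ := hlt x hx y
    have h₂ := hlt y hy x
    omega
  have hbound : ∀ x ∈ [a, b, c, d], ρ x ∈ List.range 4 := by
    intro x hx
    simp only [List.mem_cons, List.not_mem_nil, or_false] at hx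
    simp only [ρ, List.countP_cons, List.countP_nil, decide_eq_true_eq, List.mem_range]
    rcases hx with rfl | rfl | rfl | rfl <;> split_ifs <;> omega
  have hrank : isRankVector (ρ a) (ρ b) (ρ c) (ρ d) = true := by
    have key : ∀ x, ρ x = [ρ a, ρ b, ρ c, ρ d].countP fun y => y < ρ x := by
      intro x
      simp only [List.countP_cons, List.countP_nil, hlt a (by simp), hlt b (by simp),
        hlt c (by simp), hlt d (by simp)]
      simp [ρ, List.countP_cons]
    simp only [isRankVector, List.all_cons, List.all_nil, Bool.and_eq_true, beq_iff_eq]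
    exact ⟨key a, key b, key c, key d, trivial⟩
  have h := forcedClique_of_isRankVector
  simp only [List.all_eq_true] at h
  specialize h _ (hbound a (by simp)) _ (hbound b (by simp)) _ (hbound c (by simp)) _
    (hbound d (by simp))
  rw [hrank, chainMin_comp hmono] at h
  refine six_le_card_of_forcedClique quadruples hgrid _ (fun T hT S hS hTS => hsep T hT S hS ?_) h
  rwa [separated_comp fun i j k l =>
    hinj _ (chainMin_mem a b c d i j) _ (chainMin_mem a b c d k l)] at hTS

/-- The first coordinate in which two vectors differ. -/
noncomputable def firstDiff {t N : ℕ} [NeZero t] (x y : Lex (Fin t → Fin N)) : Fin t :=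
  open Classical in
  if h : ∃ i, (∀ j < i, x j = y j) ∧ x i ≠ y i then h.choose else 0

theorem firstDiff_eq {t N : ℕ} [NeZero t] {x y : Lex (Fin t → Fin N)} {i : Fin t}
    (hlt : ∀ j < i, x j = y j) (hi : x i ≠ y i) : firstDiff x y = i := by
  have h : ∃ i, (∀ j < i, x j = y j) ∧ x i ≠ y i := ⟨i, hlt, hi⟩
  rw [firstDiff, dif_pos h]
  obtain ⟨h₁, h₂⟩ := h.choose_spec
  rcases lt_trichotomy h.choose i with h' | h' | h'
  · exact absurd (hlt _ h') h₂
  · exact h'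
  · exact absurd (h₁ _ h') hi

theorem firstDiff_spec {t N : ℕ} [NeZero t] {x y : Lex (Fin t → Fin N)} (hxy : x < y) :
    (∀ j < firstDiff x y, x j = y j) ∧ x (firstDiff x y) < y (firstDiff x y) := by
  obtain ⟨i, h₁, h₂⟩ := hxy
  rw [firstDiff_eq (i := i) h₁ (ne_of_lt h₂)]
  exact ⟨h₁, h₂⟩

theorem firstDiff_eq_min {t N : ℕ} [NeZero t] {x y z : Lex (Fin t → Fin N)} (hxy : x < y)
    (hyz : y < z) : firstDiff x z = min (firstDiff x y) (firstDiff y z) := by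
  obtain ⟨h₁, h₂⟩ := firstDiff_spec hxy
  obtain ⟨h₃, h₄⟩ := firstDiff_spec hyz
  refine firstDiff_eq (fun j hj => ?_) ?_
  · rw [lt_min_iff] at hj
    exact (h₁ j hj.1).trans (h₃ j hj.2)
  · rcases lt_trichotomy (firstDiff x y) (firstDiff y z) with h | h | h
    · rw [min_eq_left h.le, ← h₃ _ h]
      exact h₂.ne
    · rw [← h, min_self]
      rw [← h] at h₄
      exact (h₂.trans h₄).ne
    · rw [min_eq_right h.le, h₁ _ h]
      exact h₄.ne

/-- Polynomial evaluation gives fingerprints of vectors, any two of which agree in at most `t`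
places. -/
theorem exists_fingerprint {t N q : ℕ} [Fact q.Prime] (ht : 1 ≤ t) (hN : N ≤ q)
    (hq : t * (N * N) ≤ q) :
    ∃ φ : (Fin t → Fin N) → Fin t × Fin N × Fin N → ZMod q, ∀ y z, y ≠ z →
      (Finset.univ.filter fun e => φ y e = φ z e).card ≤ t := by
  have hcast {M : ℕ} (hM : M ≤ q) : Function.Injective fun i : Fin M => ((i : ℕ) : ZMod q) := by
    intro i j hij
    have := (ZMod.natCast_eq_natCast_iff' _ _ _).1 hij
    rw [Nat.mod_eq_of_lt (i.2.trans_le hM), Nat.mod_eq_of_lt (j.2.trans_le hM)] at this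
    exact Fin.ext this
  have hcard : Fintype.card (Fin t × Fin N × Fin N) = t * (N * N) := by simp
  let pt : Fin t × Fin N × Fin N → ZMod q := fun e => ((Fintype.equivFinOfCardEq hcard e : ℕ))
  have hpt : Function.Injective pt := (hcast hq).comp (Equiv.injective _)
  let p : (Fin t → Fin N) → Polynomial (ZMod q) := fun y =>
    Polynomial.ofFn t fun i => ((y i : ℕ) : ZMod q)
  refine ⟨fun y e => (p y).eval (pt e), fun y z hyz => ?_⟩
  have hne : p y - p z ≠ 0 := by
    rw [sub_ne_zero]
    intro h
    have := Polynomial.injective_ofFn t h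
    exact hyz (funext fun i => hcast hN (congrFun this i))
  calc (Finset.univ.filter fun e => (p y).eval (pt e) = (p z).eval (pt e)).card
      ≤ (p y - p z).roots.toFinset.card := by
        refine Finset.card_le_card_of_injOn pt (fun e he => ?_) hpt.injOn
        simp only [Finset.coe_filter, Finset.mem_univ, true_and, Set.mem_ofPred_eq] at he
        simp [hne, he]
    _ ≤ (p y - p z).natDegree := (Multiset.toFinset_card_le _).trans (Polynomial.card_roots' _)
    _ ≤ t := (Polynomial.natDegree_sub_le _ _).trans
        (max_le (Polynomial.ofFn_natDegree_lt ht _).le (Polynomial.ofFn_natDegree_lt ht _).le)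

/-- The two colorings `f` and `g` of the edges of a grid whose sides are sets of vectors leave no
rectangle with both pairs of opposite edges of the same color. -/
theorem exists_gridColoring {t N q : ℕ} [Fact q.Prime] (ht : 1 ≤ t) (hN : N ≤ q)
    (hq : t * (N * N) ≤ q) :
    ∃ (f : (Fin t → Fin N) → Fin t × Fin N × Fin N → ZMod q)
      (g : (Fin t → Fin N) → (Fin t → Fin N) → (Fin t → Fin N) → Fin (2 ^ t)),
      ∀ x x' y z j, y ≠ z → x j ≠ x' j → f y (j, x j, x' j) = f z (j, x j, x' j) →
        g x y z ≠ g x' y z := by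
  obtain ⟨φ, hφ⟩ := exists_fingerprint (t := t) ht hN hq
  let R : (Fin t → Fin N) → (Fin t → Fin N) → Finset (Fin t × Fin N × Fin N) :=
    fun y z => Finset.univ.filter fun e => φ y e = φ z e
  have henc : ∀ y z, ∃ enc : Finset (Fin t × Fin N × Fin N) → Fin (2 ^ t),
      y ≠ z → Set.InjOn enc (R y z).powerset := by
    intro y z
    by_cases hyz : y = z
    · exact ⟨fun _ => ⟨0, by positivity⟩, fun h => absurd hyz h⟩
    · have hle : Fintype.card (R y z).powerset ≤ Fintype.card (Fin (2 ^ t)) := by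
        rw [Fintype.card_coe, Finset.card_powerset, Fintype.card_fin]
        exact Nat.pow_le_pow_right two_pos (hφ y z hyz)
      obtain ⟨enc⟩ := Function.Embedding.nonempty_of_card_le hle
      have : Nonempty (Fin (2 ^ t)) := ⟨⟨0, by positivity⟩⟩
      obtain ⟨enc', h⟩ := Set.exists_injOn_iff_injective.2 ⟨enc, enc.injective⟩
      exact ⟨enc', fun _ => h⟩
  choose enc henc using henc
  refine ⟨φ, fun x y z => enc y z ((R y z).filter fun e => x e.1 = e.2.1), ?_⟩
  intro x x' y z j hyz hx hf hg
  have hset := henc y z hyz (Finset.mem_coe.2 <| Finset.mem_powerset.2 <| Finset.filter_subset _ _)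
    (Finset.mem_coe.2 <| Finset.mem_powerset.2 <| Finset.filter_subset _ _) hg
  have hmem : (j, x j, x' j) ∈ (R y z).filter fun e => x e.1 = e.2.1 := by simp [R, hf]
  rw [hset, Finset.mem_filter] at hmem
  exact hx hmem.2.symm

/-- The values of three vectors in a given coordinate. -/
def tripleAt {t N : ℕ} (x y z : Lex (Fin t → Fin N)) (i : Fin t) : Fin N × Fin N × Fin N :=
  (x i, y i, z i)

theorem ne_of_splitAt {t N : ℕ} [NeZero t] {v : Fin 5 → Lex (Fin t → Fin N)} (hv : StrictMono v)
    {M : ℕ → ℕ → ℕ} (hM : ∀ i j : Fin 5, i < j → (firstDiff (v i) (v j) : ℕ) = M i j)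
    {e : Fin t} {i j : Fin 5} (h : splitAt M e i j = true) : v i e ≠ v j e := by
  simp only [splitAt, Bool.and_eq_true, bne_iff_ne, ne_eq, beq_iff_eq] at h
  obtain ⟨hne, hMe⟩ := h
  rcases lt_or_gt_of_ne hne with hij | hij
  · rw [min_eq_left hij.le, max_eq_right hij.le, ← hM i j hij] at hMe
    have := (firstDiff_spec (hv hij)).2.ne
    rwa [Fin.ext hMe] at this
  · rw [min_eq_right (le_of_lt hij), max_eq_left (le_of_lt hij), ← hM j i hij] at hMe
    have := (firstDiff_spec (hv hij)).2.ne'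
    rwa [Fin.ext hMe] at this

theorem firstDiff_eq_chainMin {t N : ℕ} [NeZero t] {v : Fin 5 → Lex (Fin t → Fin N)}
    (hv : StrictMono v) (i j : Fin 5) (hij : i < j) :
    (firstDiff (v i) (v j) : ℕ) = chainMin (firstDiff (v 0) (v 1)) (firstDiff (v 1) (v 2))
      (firstDiff (v 2) (v 3)) (firstDiff (v 3) (v 4)) i j := by
  have h (i j k : Fin 5) (hij : i < j) (hjk : j < k) : (firstDiff (v i) (v k) : ℕ) =
      min (firstDiff (v i) (v j) : ℕ) (firstDiff (v j) (v k)) := by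
    rw [firstDiff_eq_min (hv hij) (hv hjk)]
    exact Fin.val_strictMono.monotone.map_min
  have h02 := h 0 1 2 (by decide) (by decide)
  have h13 := h 1 2 3 (by decide) (by decide)
  have h24 := h 2 3 4 (by decide) (by decide)
  have h03 := h 0 1 3 (by decide) (by decide)
  have h14 := h 1 2 4 (by decide) (by decide)
  have h04 := h 0 1 4 (by decide) (by decide)
  rw [h24] at h14
  rw [h13] at h03
  rw [h14] at h04
  fin_cases i <;> fin_cases j <;> first
    | exact absurd hij (by decide)
    | rfl
    | assumption

theorem exists_orderedTripleColoring {t N q r : ℕ} [NeZero t] [Fact q.Prime] (hN : N ≤ q)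
    (hq : t * (N * N) ≤ q)
    (hr : t * t * (N * (N * N) * (N * (N * N)) * (q * 2 ^ t)) ≤ r) :
    ∃ C : Lex (Fin t → Fin N) → Lex (Fin t → Fin N) → Lex (Fin t → Fin N) → Fin r,
      ∀ v : Fin 5 → Lex (Fin t → Fin N), StrictMono v →
        6 ≤ (triples.toFinset.image fun T => C (v T.1) (v T.2.1) (v T.2.2)).card := by
  obtain ⟨f, g, hfg⟩ := exists_gridColoring (t := t) (NeZero.one_le) hN hq
  obtain ⟨code⟩ : Nonempty ((Fin t × Fin t) × ((Fin N × Fin N × Fin N) × (Fin N × Fin N × Fin N)) ×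
      ZMod q × Fin (2 ^ t) ↪ Fin r) :=
    Function.Embedding.nonempty_of_card_le (by simpa [ZMod.card] using hr)
  refine ⟨fun x y z => code ((firstDiff x y, firstDiff y z),
    (tripleAt x y z (firstDiff x y), tripleAt x y z (firstDiff y z)),
    f (ofLex z) (firstDiff x y, x (firstDiff x y), y (firstDiff x y)),
    g (ofLex x) (ofLex y) (ofLex z)), fun v hv => ?_⟩
  have hM := firstDiff_eq_chainMin hv
  refine six_le_card_of_separated (firstDiff (v 0) (v 1)) (firstDiff (v 1) (v 2))
    (firstDiff (v 2) (v 3)) (firstDiff (v 3) (v 4)) (fun T hT S hS hTS hC => ?_) (fun Q hQ => ?_)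
  · generalize chainMin (firstDiff (v 0) (v 1)) (firstDiff (v 1) (v 2)) (firstDiff (v 2) (v 3))
      (firstDiff (v 3) (v 4)) = M at hM hTS
    obtain ⟨hT₁, hT₂⟩ := lt_of_mem_triples T hT
    obtain ⟨hS₁, hS₂⟩ := lt_of_mem_triples S hS
    simp only [code.injective.eq_iff, tripleAt, Prod.mk.injEq] at hC
    obtain ⟨⟨hd₁, hd₂⟩, ⟨⟨h₁, h₂, h₃⟩, ⟨h₄, h₅, h₆⟩⟩, -⟩ := hC
    rw [← hd₁] at h₁ h₂ h₃
    rw [← hd₂] at h₄ h₅ h₆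
    simp only [separated, Bool.or_eq_true, bne_iff_ne, ne_eq, ← hM _ _ hT₁, ← hM _ _ hT₂,
      ← hM _ _ hS₁, ← hM _ _ hS₂, hd₁, hd₂, not_true_eq_false, false_or] at hTS
    rw [← hd₁, ← hd₂] at hTS
    rcases hTS with ((((h | h) | h) | h) | h) | h
    exacts [ne_of_splitAt hv hM h h₁, ne_of_splitAt hv hM h h₂, ne_of_splitAt hv hM h h₃,
      ne_of_splitAt hv hM h h₄, ne_of_splitAt hv hM h h₅, ne_of_splitAt hv hM h h₆]
  · obtain ⟨hpq, hsu⟩ := lt_of_mem_quadruples Q hQ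
    by_contra! hcon
    obtain ⟨h₁, h₂⟩ := hcon
    simp only [code.injective.eq_iff, Prod.mk.injEq] at h₁ h₂
    exact hfg _ _ _ _ _ (fun h => (hv hsu).ne (ofLex.injective h)) (firstDiff_spec (hv hpq)).2.ne
      h₁.2.2.1 h₂.2.2.2

theorem exists_finset_coloring {α β : Type*} [LinearOrder α] [Nonempty β] (C : α → α → α → β) :
    ∃ col : Finset α → β, ∀ x y z, x < y → y < z → col {x, y, z} = C x y z := by
  classical
  refine ⟨fun s => if h : s.card = 3 then
    C (s.orderEmbOfFin h 0) (s.orderEmbOfFin h 1) (s.orderEmbOfFin h 2) else Classical.arbitrary β,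
    fun x y z hxy hyz => ?_⟩
  have hcard : ({x, y, z} : Finset α).card = 3 :=
    Finset.card_eq_three.2 ⟨x, y, z, hxy.ne, (hxy.trans hyz).ne, hyz.ne, rfl⟩
  have hmono : StrictMono ![x, y, z] := by
    rw [Fin.strictMono_iff_lt_succ]
    intro i
    fin_cases i
    exacts [hxy, hyz]
  have h := Finset.orderEmbOfFin_unique hcard (f := ![x, y, z])
    (fun i => by fin_cases i <;> simp) hmono
  simp only [dif_pos hcard, ← h]
  rfl

theorem exists_coloring_of_card_le {t N q r n : ℕ} [NeZero t] [Fact q.Prime] (hN : N ≤ q)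
    (hq : t * (N * N) ≤ q) (hn : n ≤ N ^ t)
    (hr : t * t * (N * (N * N) * (N * (N * N)) * (q * 2 ^ t)) ≤ r) (hr0 : 0 < r) :
    ∃ col : Finset (Fin n) → Fin r, ∀ P : Finset (Fin n), P.card = 5 →
      6 ≤ ((P.powersetCard 3).image col).card := by
  classical
  obtain ⟨C, hC⟩ := exists_orderedTripleColoring (t := t) hN hq hr
  have hV : Fintype.card (Lex (Fin t → Fin N)) = N ^ t := by
    rw [Fintype.card_lex]
    simp
  let ι : Fin n ↪o Lex (Fin t → Fin N) :=
    (Fin.castLEOrderEmb hn).trans (monoEquivOfFin _ hV).toOrderEmbedding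
  have : Nonempty (Fin r) := ⟨⟨0, hr0⟩⟩
  obtain ⟨col, hcol⟩ := exists_finset_coloring fun x y z : Fin n => C (ι x) (ι y) (ι z)
  refine ⟨col, fun P hP => ?_⟩
  let v : Fin 5 ↪o Fin n := P.orderEmbOfFin hP
  have h6 := hC (fun i => ι (v i)) (ι.strictMono.comp v.strictMono)
  refine h6.trans (Finset.card_le_card fun y hy => ?_)
  obtain ⟨T, hT, rfl⟩ := Finset.mem_image.1 hy
  obtain ⟨h₁, h₂⟩ := lt_of_mem_triples T (List.mem_toFinset.1 hT)
  have h₁ := v.strictMono h₁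
  have h₂ := v.strictMono h₂
  refine Finset.mem_image.2 ⟨{v T.1, v T.2.1, v T.2.2}, Finset.mem_powersetCard.2 ⟨?_, ?_⟩,
    hcol _ _ _ h₁ h₂⟩
  · intro x hx
    simp only [Finset.mem_insert, Finset.mem_singleton] at hx
    rcases hx with rfl | rfl | rfl <;> exact P.orderEmbOfFin_mem hP _
  · exact Finset.card_eq_three.2 ⟨_, _, _, h₁.ne, (h₁.trans h₂).ne, h₂.ne, rfl⟩

theorem exists_coloring_of_two_pow_le {m r n : ℕ} (hm : 1 ≤ m) (hr : 2 ^ (13 * m) ≤ r)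
    (hn : n ≤ 2 ^ (m * m)) :
    ∃ col : Finset (Fin n) → Fin r, ∀ P : Finset (Fin n), P.card = 5 →
      6 ≤ ((P.powersetCard 3).image col).card := by
  have hN : 1 ≤ 2 ^ m := Nat.one_le_two_pow
  obtain ⟨q, hqp, hq₁, hq₂⟩ :=
    Nat.exists_prime_lt_and_le_two_mul (m * (2 ^ m * 2 ^ m)) (by positivity)
  have : Fact q.Prime := ⟨hqp⟩
  have : NeZero m := ⟨by omega⟩
  have hmN : m ≤ 2 ^ m := Nat.lt_two_pow_self.le
  have h2N : 2 ≤ 2 ^ m := Nat.le_self_pow (by omega) 2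
  refine exists_coloring_of_card_le (t := m) (N := 2 ^ m) (q := q) ?_ hq₁.le
    (by rwa [← pow_mul]) (le_trans ?_ hr) (lt_of_lt_of_le (by positivity) hr)
  · nlinarith
  · rw [mul_comm 13 m, pow_mul]
    generalize 2 ^ m = N at *
    calc m * m * (N * (N * N) * (N * (N * N)) * (q * N))
        ≤ N * N * (N * (N * N) * (N * (N * N)) * (N * (N * (N * N)) * N)) := by
          gcongr
          exact hq₂.trans (by gcongr)
      _ = N ^ 13 := by ring

/-- There is a constant `c > 0` such that `F_3(r,5,6) ≥ 2^{c (log r)²}` for every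
positive integer `r`: for every `n < 2^{c (log r)²}` there is a coloring of the
3-element subsets of an `n`-element set with `r` colors such that every set of
5 vertices spans at least 6 distinct colors on its 3-subsets. -/
theorem F3_5_6_superpolynomial :
    ∃ c : ℝ, 0 < c ∧ ∀ r : ℕ, 1 ≤ r → ∀ n : ℕ,
      (n : ℝ) < 2 ^ (c * (Real.logb 2 r) ^ 2) →
      ∃ col : Finset (Fin n) → Fin r,
        ∀ P : Finset (Fin n), P.card = 5 →
          6 ≤ ((P.powersetCard 3).image col).card := by
  refine ⟨1 / 676, by norm_num, fun r hr n hn => ?_⟩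
  have hr' : (1 : ℝ) ≤ r := by exact_mod_cast hr
  have hlog0 : 0 ≤ Real.logb 2 r := Real.logb_nonneg one_lt_two hr'
  rcases lt_or_ge r (2 ^ 13) with hsmall | hlarge
  · have hlog : Real.logb 2 r ≤ 13 := by
      rw [Real.logb_le_iff_le_rpow one_lt_two (by linarith)]
      exact_mod_cast hsmall.le
    have hn2 : (n : ℝ) < 2 := by
      refine hn.trans_le ?_
      calc (2 : ℝ) ^ (1 / 676 * Real.logb 2 r ^ 2) ≤ 2 ^ (1 : ℝ) :=
            Real.rpow_le_rpow_of_exponent_le one_le_two (by nlinarith)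
        _ = 2 := Real.rpow_one 2
    have hn2 : n < 2 := by exact_mod_cast hn2
    refine ⟨fun _ => ⟨0, hr⟩, fun P hP => ?_⟩
    have := P.card_le_univ
    rw [Fintype.card_fin] at this
    omega
  · have h13 : 13 ≤ Nat.log 2 r := Nat.le_log_of_pow_le one_lt_two hlarge
    obtain ⟨m, hm⟩ : ∃ m, m = Nat.log 2 r / 13 := ⟨_, rfl⟩
    have hm1 : 1 ≤ m := by omega
    have hlog : Real.logb 2 r ≤ 26 * m := by
      rw [Real.logb_le_iff_le_rpow one_lt_two (by linarith)]
      have h₁ : r < 2 ^ (Nat.log 2 r + 1) := Nat.lt_pow_succ_log_self one_lt_two r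
      have h₂ : r ≤ 2 ^ (26 * m) := h₁.le.trans (Nat.pow_le_pow_right two_pos (by omega))
      calc (r : ℝ) ≤ (2 : ℝ) ^ (26 * m) := by exact_mod_cast h₂
        _ = 2 ^ (26 * m : ℝ) := by
          rw [← Real.rpow_natCast]
          push_cast
          rfl
    refine exists_coloring_of_two_pow_le hm1 ?_ ?_
    · exact (Nat.pow_le_pow_right two_pos (by omega)).trans (Nat.pow_log_le_self 2 (by omega))
    · have : (n : ℝ) ≤ (2 : ℝ) ^ (m * m) := by
        refine hn.le.trans ?_
        rw [← Real.rpow_natCast 2 (m * m)]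
        push_cast
        refine Real.rpow_le_rpow_of_exponent_le one_le_two ?_
        nlinarith
      exact_mod_cast this
end

section
/- For all positive integers n, g(n) ≤ f_3(2n, 4, 3) ≤ 2⌈log n⌉² · g(n). -/
/-- Two vertices of the grid graph `Γ_{m,n}` are adjacent iff they are distinct
and agree in one of the coordinates. -/
def gridAdj {m n : ℕ} (x y : Fin m × Fin n) : Prop :=
  x ≠ y ∧ (x.1 = y.1 ∨ x.2 = y.2)

/-- `g m n` is the minimum number of colors in an alternating-rectangle-free
edge coloring of the grid graph `Γ_{m,n}`. -/
noncomputable def gGrid (m n : ℕ) : ℕ :=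
  sInf {r : ℕ | ∃ c : Sym2 (Fin m × Fin n) → ℕ,
    (∀ x y : Fin m × Fin n, gridAdj x y → c s(x, y) < r) ∧ ¬ HasAltRect c}

/-- `f3 n p q` is the minimum number `r` of colors in a coloring of the 3-element
subsets of an `n`-element set such that every `p` vertices span at least `q`
distinct colors on their 3-subsets. -/
noncomputable def f3 (n p q : ℕ) : ℕ :=
  sInf {r : ℕ | ∃ c : Finset (Fin n) → ℕ,
    (∀ s : Finset (Fin n), s.card = 3 → c s < r) ∧
    ∀ P : Finset (Fin n), P.card = p → q ≤ ((P.powersetCard 3).image c).card}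

/-! ### The splitting level of two binary expansions -/

/-- The least `d` such that `x` and `y` have the same binary digits from position `d` upwards. -/
def splitLevel (x y : ℕ) : ℕ :=
  Nat.find (p := fun d => x / 2 ^ d = y / 2 ^ d) ⟨x + y, by
    have h : x + y < 2 ^ (x + y) := Nat.lt_two_pow_self
    rw [Nat.div_eq_of_lt (by omega), Nat.div_eq_of_lt (by omega)]⟩

theorem splitLevel_le_iff {x y d : ℕ} : splitLevel x y ≤ d ↔ x / 2 ^ d = y / 2 ^ d := by
  refine ⟨fun h => ?_, fun h => Nat.find_min' _ h⟩
  have hs : x / 2 ^ splitLevel x y = y / 2 ^ splitLevel x y :=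
    Nat.find_spec (p := fun d => x / 2 ^ d = y / 2 ^ d) _
  obtain ⟨e, rfl⟩ := Nat.exists_eq_add_of_le h
  rw [pow_add, ← Nat.div_div_eq_div_mul, ← Nat.div_div_eq_div_mul, hs]

theorem splitLevel_pos {x y : ℕ} (h : x ≠ y) : 0 < splitLevel x y := by
  by_contra h0
  exact h (by simpa using splitLevel_le_iff.1 (not_lt.1 h0))

theorem splitLevel_eq_max {x y z : ℕ} (hxy : x ≤ y) (hyz : y ≤ z) :
    splitLevel x z = max (splitLevel x y) (splitLevel y z) := by
  refine eq_of_forall_ge_iff fun d => ?_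
  rw [max_le_iff, splitLevel_le_iff, splitLevel_le_iff, splitLevel_le_iff]
  have h1 : x / 2 ^ d ≤ y / 2 ^ d := Nat.div_le_div_right hxy
  have h2 : y / 2 ^ d ≤ z / 2 ^ d := Nat.div_le_div_right hyz
  omega

theorem splitLevel_ne {x y z : ℕ} (hxy : x < y) (hyz : y < z) :
    splitLevel x y ≠ splitLevel y z := by
  intro h
  obtain ⟨e, he⟩ := Nat.exists_eq_succ_of_ne_zero (splitLevel_pos hxy.ne).ne'
  have h1 := splitLevel_le_iff.1 he.le
  have h2 := splitLevel_le_iff.1 (h.symm.trans he).le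
  have h3 := mt (splitLevel_le_iff (x := x) (y := y) (d := e)).2 (by omega)
  have h4 := mt (splitLevel_le_iff (x := y) (y := z) (d := e)).2 (by omega)
  have h5 : x / 2 ^ e ≤ y / 2 ^ e := Nat.div_le_div_right hxy.le
  have h6 : y / 2 ^ e ≤ z / 2 ^ e := Nat.div_le_div_right hyz.le
  rw [Nat.succ_eq_add_one, pow_succ, ← Nat.div_div_eq_div_mul, ← Nat.div_div_eq_div_mul] at h1 h2
  omega

/-! ### Colorings of triples -/

theorem exists_lt_lt_of_card_eq_three {α : Type*} [LinearOrder α] {s : Finset α}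
    (h : s.card = 3) : ∃ x y z, x < y ∧ y < z ∧ s = {x, y, z} := by
  refine ⟨s.orderEmbOfFin h 0, s.orderEmbOfFin h 1, s.orderEmbOfFin h 2, by simp, by simp, ?_⟩
  ext a
  rw [← Finset.mem_coe, ← Finset.range_orderEmbOfFin s h, Set.mem_range]
  simp [Fin.exists_fin_succ, eq_comm]

theorem exists_lt_lt_lt_of_card_eq_four {α : Type*} [LinearOrder α] {s : Finset α}
    (h : s.card = 4) : ∃ x y z w, x < y ∧ y < z ∧ z < w ∧ s = {x, y, z, w} := by
  refine ⟨s.orderEmbOfFin h 0, s.orderEmbOfFin h 1, s.orderEmbOfFin h 2, s.orderEmbOfFin h 3,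
    by simp, by simp, by simp [Fin.lt_def], ?_⟩
  ext a
  rw [← Finset.mem_coe, ← Finset.range_orderEmbOfFin s h, Set.mem_range]
  simp [Fin.exists_fin_succ, eq_comm]

/-- Every function of increasing triples is induced by a function of 3-element sets. -/
theorem exists_triple_coloring {α β : Type*} [LinearOrder α] [Inhabited β] (C : α → α → α → β) :
    ∃ c : Finset α → β, ∀ x y z, x < y → y < z → c {x, y, z} = C x y z := by
  classical
  refine ⟨fun s => if h : s.card = 3 then
    C (s.orderEmbOfFin h 0) (s.orderEmbOfFin h 1) (s.orderEmbOfFin h 2) else default, ?_⟩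
  intro x y z hxy hyz
  have h : ({x, y, z} : Finset α).card = 3 :=
    Finset.card_eq_three.2 ⟨x, y, z, hxy.ne, (hxy.trans hyz).ne, hyz.ne, rfl⟩
  have he : (![x, y, z] : Fin 3 → α) = ({x, y, z} : Finset α).orderEmbOfFin h := by
    refine Finset.orderEmbOfFin_unique h (fun i => ?_) ?_
    · fin_cases i <;> simp
    · rw [Fin.strictMono_iff_lt_succ]
      intro i
      fin_cases i <;> simpa
  simp only [h, dif_pos, ← he]
  rfl

theorem mem_powersetCard_three_iff {α : Type*} [DecidableEq α] {a b c d : α} {s : Finset α}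
    (hab : a ≠ b) (hac : a ≠ c) (had : a ≠ d) (hbc : b ≠ c) (hbd : b ≠ d) (hcd : c ≠ d) :
    s ∈ ({a, b, c, d} : Finset α).powersetCard 3 ↔
      s = {a, b, c} ∨ s = {a, b, d} ∨ s = {a, c, d} ∨ s = {b, c, d} := by
  have h4 : ({a, b, c, d} : Finset α).card = 4 := by simp [*]
  rw [Finset.mem_powersetCard]
  constructor
  · rintro ⟨hs, h3⟩
    obtain ⟨x, hx, hxs⟩ := Finset.exists_mem_notMem_of_card_lt_card (h3.trans_lt (by omega : 3 < ({a, b, c, d} : Finset α).card))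
    have he : s = ({a, b, c, d} : Finset α).erase x := by
      refine Finset.eq_of_subset_of_card_le (fun y hy => ?_) ?_
      · exact Finset.mem_erase.2 ⟨fun h => hxs (h ▸ hy), hs hy⟩
      · rw [Finset.card_erase_of_mem hx]
        omega
    simp only [Finset.mem_insert, Finset.mem_singleton] at hx
    rcases hx with rfl | rfl | rfl | rfl
    · right; right; right; rw [he]; ext; simp; grind
    · right; right; left; rw [he]; ext; simp; grind
    · right; left; rw [he]; ext; simp; grind
    · left; rw [he]; ext; simp; grind
  · rintro (rfl | rfl | rfl | rfl) <;> simp [*, Finset.subset_iff]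

theorem exists_nat_triple_coloring {n p q : ℕ} {α : Type*} [DecidableEq α] (T : Finset α)
    (c : Finset (Fin n) → α) (hT : ∀ s : Finset (Fin n), s.card = 3 → c s ∈ T)
    (hc : ∀ P : Finset (Fin n), P.card = p → q ≤ ((P.powersetCard 3).image c).card) :
    ∃ c' : Finset (Fin n) → ℕ, (∀ s : Finset (Fin n), s.card = 3 → c' s < T.card) ∧
      ∀ P : Finset (Fin n), P.card = p → q ≤ ((P.powersetCard 3).image c').card := by
  classical
  let f : α → ℕ := fun a => if h : a ∈ T then T.equivFin ⟨a, h⟩ else 0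
  have hf : Set.InjOn f T := by
    intro a ha b hb hab
    have ha' : a ∈ T := ha
    have hb' : b ∈ T := hb
    simpa [f, ha', hb', Fin.val_inj] using hab
  refine ⟨f ∘ c, fun s hs => ?_, fun P hP => ?_⟩
  · simp [f, hT s hs]
  · rw [← Finset.image_image, Finset.card_image_of_injOn]
    · exact hc P hP
    · refine hf.mono ?_
      intro a ha
      obtain ⟨s, hs, rfl⟩ := Finset.mem_image.1 ha
      exact hT s (Finset.mem_powersetCard.1 hs).2

/-! ### Grid colorings -/

theorem exists_gGrid_coloring (m n : ℕ) :
    ∃ c : Sym2 (Fin m × Fin n) → ℕ,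
      (∀ x y : Fin m × Fin n, gridAdj x y → c s(x, y) < gGrid m n) ∧ ¬ HasAltRect c := by
  classical
  have hne : {r : ℕ | ∃ c : Sym2 (Fin m × Fin n) → ℕ,
      (∀ x y : Fin m × Fin n, gridAdj x y → c s(x, y) < r) ∧ ¬ HasAltRect c}.Nonempty := by
    refine ⟨_, fun e => Fintype.equivFin (Sym2 (Fin m × Fin n)) e, fun x y _ => Fin.is_lt _, ?_⟩
    rintro ⟨i, i', j, j', hi, hj, h, -⟩
    rw [Fin.val_inj, (Fintype.equivFin _).injective.eq_iff] at h
    simp at h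
    omega
  exact Nat.sInf_mem hne

/-- Restricting a coloring of triples to the triples which meet both halves of the vertex set
gives an alternating-free coloring of the grid. -/
theorem gGrid_le_of_triple_coloring {n r : ℕ} (c : Finset (Fin (2 * n)) → ℕ)
    (hr : ∀ s : Finset (Fin (2 * n)), s.card = 3 → c s < r)
    (hc : ∀ P : Finset (Fin (2 * n)), P.card = 4 → 3 ≤ ((P.powersetCard 3).image c).card) :
    gGrid n n ≤ r := by
  let L : Fin n → Fin (2 * n) := fun i => ⟨i, by omega⟩
  let R : Fin n → Fin (2 * n) := fun i => ⟨n + i, by omega⟩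
  have hL : ∀ i i', L i = L i' ↔ i = i' := fun i i' => by simp [L, Fin.ext_iff]
  have hR : ∀ i i', R i = R i' ↔ i = i' := fun i i' => by simp [R, Fin.ext_iff]
  have hLR : ∀ i i', L i ≠ R i' := fun i i' => by simp only [L, R, ne_eq, Fin.ext_iff]; omega
  refine Nat.sInf_le ⟨fun e => c (e.lift ⟨fun x y => {L x.1, L y.1, R x.2, R y.2}, ?_⟩), ?_, ?_⟩
  · intro x y
    ext a
    simp only [Finset.mem_insert, Finset.mem_singleton]
    tauto
  · rintro ⟨i, j⟩ ⟨i', j'⟩ ⟨hne, h⟩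
    apply hr
    simp only [Sym2.lift_mk]
    dsimp only at h
    rcases h with rfl | rfl
    · have hj : j ≠ j' := fun h => hne (by rw [h])
      refine Finset.card_eq_three.2 ⟨L i, R j, R j', hLR _ _, hLR _ _, by rwa [ne_eq, hR], ?_⟩
      simp
    · have hi : i ≠ i' := fun h => hne (by rw [h])
      refine Finset.card_eq_three.2 ⟨L i, L i', R j, by rwa [ne_eq, hL], hLR _ _, hLR _ _, ?_⟩
      simp
  · rintro ⟨i, i', j, j', hi, hj, h1, h2⟩
    simp only [Sym2.lift_mk, Finset.pair_eq_singleton, Finset.insert_idem] at h1 h2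
    have hi' : L i ≠ L i' := by rw [ne_eq, hL]; exact hi.ne
    have hj' : R j ≠ R j' := by rw [ne_eq, hR]; exact hj.ne
    have h3 := hc {L i, L i', R j, R j'} (by simp [hi', hj', hLR])
    have hsub : (({L i, L i', R j, R j'} : Finset _).powersetCard 3).image c ⊆
        {c {L i, L i', R j}, c {L i, R j, R j'}} := by
      intro a ha
      obtain ⟨s, hs, rfl⟩ := Finset.mem_image.1 ha
      rw [mem_powersetCard_three_iff hi' (hLR _ _) (hLR _ _) (hLR _ _) (hLR _ _) hj'] at hs
      rcases hs with rfl | rfl | rfl | rfl <;> simp [h1, h2]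
    have := (Finset.card_le_card hsub).trans Finset.card_le_two
    omega

/-- A coloring of increasing triples by pairs of splitting levels, the side containing two of the
vertices, and the color of an edge of the grid. -/
def levelColor {α : Type*} {n : ℕ} (lab : α → ℕ) (pos : α → Fin n)
    (χ : Sym2 (Fin n × Fin n) → ℕ) (x y z : α) : ℕ × ℕ × ℕ × ℕ :=
  if splitLevel (lab x) (lab y) < splitLevel (lab y) (lab z) then
    (splitLevel (lab x) (lab y), splitLevel (lab y) (lab z), 0,
      χ s((pos x, pos z), (pos y, pos z)))
  else
    (splitLevel (lab y) (lab z), splitLevel (lab x) (lab y), 1,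
      χ s((pos x, pos y), (pos x, pos z)))

theorem levelColor_mem {α : Type*} [LinearOrder α] {n k r : ℕ} {lab : α → ℕ} {pos : α → Fin n}
    {χ : Sym2 (Fin n × Fin n) → ℕ} (hlab : StrictMono lab) (hk : ∀ x, lab x < 2 ^ (k + 1))
    (hpos : ∀ x y, x < y → splitLevel (lab x) (lab y) ≤ k → pos x < pos y)
    (hχ : ∀ x y, gridAdj x y → χ s(x, y) < r) {x y z : α} (hxy : x < y) (hyz : y < z) :
    levelColor lab pos χ x y z ∈
      Finset.Ico 1 (k + 1) ×ˢ Finset.Ico 2 (k + 2) ×ˢ Finset.range 2 ×ˢ Finset.range r := by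
  have hle : ∀ u v, splitLevel (lab u) (lab v) ≤ k + 1 := fun u v => by
    rw [splitLevel_le_iff, Nat.div_eq_of_lt (hk u), Nat.div_eq_of_lt (hk v)]
  have h1 := hle x y
  have h2 := hle y z
  have h3 := splitLevel_pos (hlab hxy).ne
  have h4 := splitLevel_pos (hlab hyz).ne
  have h5 := splitLevel_ne (hlab hxy) (hlab hyz)
  unfold levelColor
  split_ifs with h
  · have hp := hpos x y hxy (by omega)
    have hc := hχ (pos x, pos z) (pos y, pos z) ⟨fun he => hp.ne (Prod.ext_iff.1 he).1, .inr rfl⟩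
    simp only [Finset.mem_product, Finset.mem_Ico, Finset.mem_range]
    omega
  · have hp := hpos y z hyz (by omega)
    have hc := hχ (pos x, pos y) (pos x, pos z) ⟨fun he => hp.ne (Prod.ext_iff.1 he).2, .inl rfl⟩
    simp only [Finset.mem_product, Finset.mem_Ico, Finset.mem_range]
    omega

theorem two_lt_card_image_levelColor {α : Type*} [LinearOrder α] {n k : ℕ} {lab : α → ℕ}
    {pos : α → Fin n} {χ : Sym2 (Fin n × Fin n) → ℕ} (hlab : StrictMono lab)
    (hk : ∀ x, lab x < 2 ^ (k + 1))
    (hpos : ∀ x y, x < y → splitLevel (lab x) (lab y) ≤ k → pos x < pos y)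
    (hχ : ¬ HasAltRect χ) {a b c d : α} (hab : a < b) (hbc : b < c) (hcd : c < d)
    {U : Finset (ℕ × ℕ × ℕ × ℕ)} (h1 : levelColor lab pos χ a b c ∈ U)
    (h2 : levelColor lab pos χ a b d ∈ U) (h3 : levelColor lab pos χ a c d ∈ U)
    (h4 : levelColor lab pos χ b c d ∈ U) : 2 < U.card := by
  rw [Finset.two_lt_card]
  have hac := hab.trans hbc
  have hbd := hbc.trans hcd
  have e1 := splitLevel_eq_max (hlab hab).le (hlab hbc).le
  have e2 := splitLevel_eq_max (hlab hbc).le (hlab hcd).le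
  have n1 := splitLevel_ne (hlab hab) (hlab hbc)
  have n2 := splitLevel_ne (hlab hbc) (hlab hcd)
  have n3 := splitLevel_ne (hlab hac) (hlab hcd)
  have n4 := splitLevel_ne (hlab hab) (hlab hbd)
  have hle : splitLevel (lab b) (lab c) ≤ k + 1 := by
    rw [splitLevel_le_iff, Nat.div_eq_of_lt (hk b), Nat.div_eq_of_lt (hk c)]
  have pab := hpos a b hab
  have pcd := hpos c d hcd
  unfold levelColor at h1 h2 h3 h4
  rw [e2] at h2 n4
  rw [e1] at h3 n3
  generalize splitLevel (lab a) (lab b) = p at *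
  generalize splitLevel (lab b) (lab c) = q at *
  generalize splitLevel (lab c) (lab d) = r at *
  by_cases hmid : p < q ∧ r < q
  · rw [if_pos (by omega)] at h1 h2
    rw [if_neg (by omega)] at h3 h4
    rw [max_eq_left (by omega)] at h2
    rw [max_eq_right (by omega)] at h3
    by_cases hcol : χ s((pos a, pos c), (pos b, pos c)) = χ s((pos a, pos d), (pos b, pos d))
    · refine ⟨_, h1, _, h3, _, h4, by simp, by simp, fun he => hχ ?_⟩
      simp only [Prod.mk.injEq, true_and] at he
      exact ⟨pos a, pos b, pos c, pos d, pab (by omega), pcd (by omega), hcol, he⟩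
    · exact ⟨_, h1, _, h2, _, h3, by simp [hcol], by simp, by simp⟩
  · rcases lt_or_ge p q with hpq | hpq
    · have hqr : q < r := by omega
      rw [if_pos (by omega)] at h1 h2 h3
      refine ⟨_, h1, _, h2, _, h3, ?_, ?_, ?_⟩ <;> simp only [ne_eq, Prod.mk.injEq] <;> omega
    · rcases lt_or_ge q r with hqr | hqr
      · rw [if_neg (by omega)] at h1
        by_cases hpr : p < r
        · rw [if_pos (by omega)] at h2 h4
          refine ⟨_, h1, _, h2, _, h4, ?_, ?_, ?_⟩ <;> simp only [ne_eq, Prod.mk.injEq] <;> omega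
        · rw [if_neg (by omega)] at h2 h3
          rw [if_pos (by omega)] at h4
          refine ⟨_, h1, _, h2, _, h4, ?_, ?_, ?_⟩ <;> simp only [ne_eq, Prod.mk.injEq] <;> omega
      · rw [if_neg (by omega)] at h1 h3 h4
        refine ⟨_, h1, _, h3, _, h4, ?_, ?_, ?_⟩ <;> simp only [ne_eq, Prod.mk.injEq] <;> omega

/-- Position of a vertex in its half, and a binary labelling whose leading digit names the half. -/
theorem exists_balanced_labelling (n : ℕ) :
    ∃ (lab : Fin (2 * n) → ℕ) (pos : Fin (2 * n) → Fin n), StrictMono lab ∧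
      (∀ x, lab x < 2 ^ (Nat.clog 2 n + 1)) ∧
      ∀ x y, x < y → splitLevel (lab x) (lab y) ≤ Nat.clog 2 n → pos x < pos y := by
  have hn : n ≤ 2 ^ Nat.clog 2 n := Nat.le_pow_clog one_lt_two n
  refine ⟨fun x => if (x : ℕ) < n then x else 2 ^ Nat.clog 2 n + (x - n),
    fun x => ⟨if (x : ℕ) < n then x else x - n, by split_ifs <;> omega⟩, ?_, ?_, ?_⟩
  · intro x y hxy
    rw [Fin.lt_def] at hxy
    dsimp only
    split_ifs <;> omega
  · intro x
    rw [pow_succ]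
    dsimp only
    split_ifs <;> omega
  · intro x y hxy h
    rw [splitLevel_le_iff] at h
    rw [Fin.lt_def] at hxy
    simp only [Fin.mk_lt_mk] at h ⊢
    split_ifs at h ⊢ with hx hy
    · exact hxy
    · rw [Nat.div_eq_of_lt (by omega), Nat.add_div_left _ (Nat.two_pow_pos _)] at h
      exact absurd h.symm (Nat.succ_ne_zero _)
    · omega
    · omega

theorem exists_triple_coloring_of_grid (n : ℕ) :
    ∃ c : Finset (Fin (2 * n)) → ℕ,
      (∀ s : Finset (Fin (2 * n)), s.card = 3 → c s < 2 * (Nat.clog 2 n) ^ 2 * gGrid n n) ∧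
      ∀ P : Finset (Fin (2 * n)), P.card = 4 → 3 ≤ ((P.powersetCard 3).image c).card := by
  obtain ⟨χ, hχ, halt⟩ := exists_gGrid_coloring n n
  obtain ⟨lab, pos, hlab, hk, hpos⟩ := exists_balanced_labelling n
  obtain ⟨c, hc⟩ := exists_triple_coloring (levelColor lab pos χ)
  have hcard : 2 * (Nat.clog 2 n) ^ 2 * gGrid n n =
      (Finset.Ico 1 (Nat.clog 2 n + 1) ×ˢ Finset.Ico 2 (Nat.clog 2 n + 2) ×ˢ
        Finset.range 2 ×ˢ Finset.range (gGrid n n)).card := by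
    simp only [Finset.card_product, Nat.card_Ico, Finset.card_range, Nat.add_sub_cancel]
    ring
  rw [hcard]
  refine exists_nat_triple_coloring _ c (fun s hs => ?_) fun P hP => ?_
  · obtain ⟨x, y, z, hxy, hyz, rfl⟩ := exists_lt_lt_of_card_eq_three hs
    rw [hc x y z hxy hyz]
    exact levelColor_mem hlab hk hpos hχ hxy hyz
  · obtain ⟨x, y, z, w, hxy, hyz, hzw, rfl⟩ := exists_lt_lt_lt_of_card_eq_four hP
    have hmem := fun s => mem_powersetCard_three_iff (s := s) hxy.ne (hxy.trans hyz).ne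
      (hxy.trans (hyz.trans hzw)).ne hyz.ne (hyz.trans hzw).ne hzw.ne
    refine two_lt_card_image_levelColor hlab hk hpos halt hxy hyz hzw ?_ ?_ ?_ ?_
    · exact Finset.mem_image.2 ⟨_, (hmem _).2 (by simp), hc x y z hxy hyz⟩
    · exact Finset.mem_image.2 ⟨_, (hmem _).2 (.inr (.inl rfl)), hc x y w hxy (hyz.trans hzw)⟩
    · exact Finset.mem_image.2
        ⟨_, (hmem _).2 (.inr (.inr (.inl rfl))), hc x z w (hxy.trans hyz) hzw⟩
    · exact Finset.mem_image.2 ⟨_, (hmem _).2 (.inr (.inr (.inr rfl))), hc y z w hyz hzw⟩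

/-- Proposition 4.1: for every positive integer `n`,
`g(n) ≤ f_3(2n,4,3) ≤ 2⌈log n⌉² g(n)`. -/
theorem g_le_f3_le_g (n : ℕ) (hn : 0 < n) :
    gGrid n n ≤ f3 (2 * n) 4 3 ∧
    f3 (2 * n) 4 3 ≤ 2 * (Nat.clog 2 n) ^ 2 * gGrid n n := by
  refine ⟨?_, Nat.sInf_le (exists_triple_coloring_of_grid n)⟩
  have hne : {r : ℕ | ∃ c : Finset (Fin (2 * n)) → ℕ,
      (∀ s : Finset (Fin (2 * n)), s.card = 3 → c s < r) ∧
      ∀ P : Finset (Fin (2 * n)), P.card = 4 → 3 ≤ ((P.powersetCard 3).image c).card}.Nonempty :=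
    ⟨_, exists_triple_coloring_of_grid n⟩
  obtain ⟨c, hr, hc⟩ := Nat.sInf_mem hne
  exact gGrid_le_of_triple_coloring c hr hc
end

section
/- For every positive integer r, every edge coloring of the grid graph Γ_{r+1, n} with r colors, where n = r^{C(r+1,2)} + 1, contains an alternating rectangle. Consequently, G(r) ≤ r^{C(r+1,2)} + 1. -/
/-- If there are more columns than colorings of the edges of a complete graph on `m` vertices,
and more rows than colors, then every edge coloring has an alternating rectangle. -/
theorem hasAltRect_of_pow_lt {m n : ℕ} {α : Type*} [Fintype α] (hm : Fintype.card α < m)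
    (hn : Fintype.card α ^ m.choose 2 < n) (c : Sym2 (Fin m × Fin n) → α) : HasAltRect c := by
  classical
  let pattern : Fin n → {e : Sym2 (Fin m) // ¬ e.IsDiag} → α :=
    fun j e => c (e.1.map fun i => (i, j))
  have hcard : Fintype.card ({e : Sym2 (Fin m) // ¬ e.IsDiag} → α) < Fintype.card (Fin n) := by
    rwa [Fintype.card_fun, Sym2.card_subtype_not_diag, Fintype.card_fin, Fintype.card_fin]
  obtain ⟨j, j', hj, hpat⟩ : ∃ j j', j < j' ∧ pattern j = pattern j' := by
    obtain ⟨a, b, hab, h⟩ := Fintype.exists_ne_map_eq_of_card_lt pattern hcard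
    rcases lt_or_gt_of_ne hab with hlt | hlt
    exacts [⟨a, b, hlt, h⟩, ⟨b, a, hlt, h.symm⟩]
  obtain ⟨i, i', hi, hrow⟩ : ∃ i i' : Fin m, i < i' ∧
      c s((i, j), (i, j')) = c s((i', j), (i', j')) := by
    obtain ⟨a, b, hab, h⟩ := Fintype.exists_ne_map_eq_of_card_lt
      (fun i : Fin m => c s((i, j), (i, j'))) (by rwa [Fintype.card_fin])
    rcases lt_or_gt_of_ne hab with hlt | hlt
    exacts [⟨a, b, hlt, h⟩, ⟨b, a, hlt, h.symm⟩]
  exact ⟨i, i', j, j', hi, hj, congrFun hpat ⟨s(i, i'), by simpa using hi.ne⟩, hrow⟩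

/-- An alternating rectangle in the coloring induced on a subset of the rows is one in the
whole grid. -/
theorem HasAltRect.of_rows {k m n : ℕ} {α : Type*} {f : Fin k → Fin m} (hf : StrictMono f)
    {c : Sym2 (Fin m × Fin n) → α}
    (h : HasAltRect fun e : Sym2 (Fin k × Fin n) => c (e.map (Prod.map f id))) :
    HasAltRect c := by
  obtain ⟨i, i', j, j', hi, hj, hcol, hrow⟩ := h
  exact ⟨f i, f i', j, j', hf hi, hj, hcol, hrow⟩

/-- Shelah's bound: for every positive integer `r`, with `n = r^{C(r+1,2)} + 1`,
every edge coloring of `Γ_{r+1,n}` with `r` colors contains an alternating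
rectangle; consequently every edge coloring of `Γ_{n,n}` with `r` colors contains
an alternating rectangle, i.e. `G(r) ≤ r^{C(r+1,2)} + 1`. -/
theorem shelah_upper_bound (r : ℕ) (hr : 0 < r) :
    (∀ c : Sym2 (Fin (r + 1) × Fin (r ^ Nat.choose (r + 1) 2 + 1)) → Fin r,
      HasAltRect c) ∧
    (∀ c : Sym2 (Fin (r ^ Nat.choose (r + 1) 2 + 1) ×
        Fin (r ^ Nat.choose (r + 1) 2 + 1)) → Fin r,
      HasAltRect c) := by
  have hrect : ∀ c : Sym2 (Fin (r + 1) × Fin (r ^ Nat.choose (r + 1) 2 + 1)) → Fin r,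
      HasAltRect c := hasAltRect_of_pow_lt (by simp) (by simp)
  have hchoose : Nat.choose (r + 1) 2 ≠ 0 := (Nat.choose_pos (by lia)).ne'
  have hle : r + 1 ≤ r ^ Nat.choose (r + 1) 2 + 1 :=
    Nat.succ_le_succ (Nat.le_self_pow hchoose r)
  exact ⟨hrect, fun c => .of_rows (Fin.strictMono_castLE hle) (hrect _)⟩
end

section
/- For every integer r ≥ 2, every edge coloring of the complete graph on r² + 2 vertices with r colors contains a set of 4 vertices on which at most 3 distinct colors appear; that is, F(r, 4, 4) ≤ r² + 2. -/
/-- If three edges at `v` have color `i`, and the edge `ux` has color `i` or the color of `uy`,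
then the pairs in `{v, u, x, y}` receive at most three colors. -/
theorem card_image_powersetCard_two_le_three {V K : Type*} [DecidableEq V] [DecidableEq K]
    (c : Finset V → K) {v u x y : V} {i : K} (hu : c {v, u} = i) (hx : c {v, x} = i)
    (hy : c {v, y} = i) (h : c {u, x} = i ∨ c {u, x} = c {u, y}) :
    ((({v, u, x, y} : Finset V).powersetCard 2).image c).card ≤ 3 := by
  have hsub : (({v, u, x, y} : Finset V).powersetCard 2).image c ⊆ {i, c {u, y}, c {x, y}} := by
    intro k hk
    obtain ⟨e, he, rfl⟩ := Finset.mem_image.1 hk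
    obtain ⟨he, hcard⟩ := Finset.mem_powersetCard.1 he
    obtain ⟨a, b, hab, rfl⟩ := Finset.card_eq_two.1 hcard
    have ha : a ∈ ({v, u, x, y} : Finset V) := he (by simp)
    have hb : b ∈ ({v, u, x, y} : Finset V) := he (by simp)
    simp only [Finset.mem_insert, Finset.mem_singleton] at ha hb ⊢
    have hcomm : ∀ s t : V, c {s, t} = c {t, s} := fun s t => by rw [Finset.pair_comm]
    rcases ha with rfl | rfl | rfl | rfl <;> rcases hb with rfl | rfl | rfl | rfl <;> grind
  exact (Finset.card_le_card hsub).trans Finset.card_le_three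

/-- `F(r,4,4) ≤ r² + 2`: for every integer `r ≥ 2`, every edge coloring of the
complete graph on `r² + 2` vertices with `r` colors (viewed as a coloring of the
2-element subsets) contains a set of 4 vertices whose pairs receive at most 3
distinct colors. -/
theorem F_r_4_4_upper (r : ℕ) (hr : 2 ≤ r) :
    ∀ c : Finset (Fin (r ^ 2 + 2)) → Fin r,
      ∃ P : Finset (Fin (r ^ 2 + 2)), P.card = 4 ∧
        ((P.powersetCard 2).image c).card ≤ 3 := by
  intro c
  let v : Fin (r ^ 2 + 2) := 0
  obtain ⟨i, -, hi⟩ := Finset.exists_lt_card_fiber_of_mul_lt_card_of_maps_to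
    (s := Finset.univ.erase v) (t := Finset.univ) (f := fun w => c {v, w}) (n := r)
    (fun _ _ => Finset.mem_univ _) (by simp [Finset.card_erase_of_mem]; nlinarith)
  set N := (Finset.univ.erase v).filter fun w => c {v, w} = i with hN
  have hmem : ∀ w ∈ N, w ≠ v ∧ c {v, w} = i := fun w hw => by simpa [hN] using hw
  have key : ∀ u ∈ N, ∀ x ∈ N, ∀ y ∈ N, u ≠ x → u ≠ y → x ≠ y →
      (c {u, x} = i ∨ c {u, x} = c {u, y}) →
      ∃ P : Finset (Fin (r ^ 2 + 2)), P.card = 4 ∧ ((P.powersetCard 2).image c).card ≤ 3 := by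
    intro u hu x hx y hy hux huy hxy h
    obtain ⟨huv, hu⟩ := hmem u hu
    obtain ⟨hxv, hx⟩ := hmem x hx
    obtain ⟨hyv, hy⟩ := hmem y hy
    refine ⟨{v, u, x, y}, ?_, card_image_powersetCard_two_le_three c hu hx hy h⟩
    simp [Finset.card_insert_of_notMem, huv.symm, hxv.symm, hyv.symm, hux, huy, hxy]
  obtain ⟨u, hu⟩ : N.Nonempty := Finset.card_pos.1 (by omega)
  by_cases h : ∃ x ∈ N, u ≠ x ∧ c {u, x} = i
  · obtain ⟨x, hx, hux, hc⟩ := h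
    obtain ⟨y, hy, hyn⟩ := Finset.exists_mem_notMem_of_card_lt_card
      (s := {u, x}) (t := N) (Finset.card_le_two.trans_lt (by omega))
    simp only [Finset.mem_insert, Finset.mem_singleton, not_or] at hyn
    exact key u hu x hx y hy hux (Ne.symm hyn.1) (Ne.symm hyn.2) (Or.inl hc)
  · push Not at h
    obtain ⟨x, hx, y, hy, hxy, hc⟩ := Finset.exists_ne_map_eq_of_card_lt_of_maps_to
      (s := N.erase u) (t := Finset.univ.erase i) (f := fun w => c {u, w})
      (by simp [Finset.card_erase_of_mem, hu]; omega)
      (fun w hw => by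
        have := Finset.mem_erase.1 hw
        simpa using h w this.2 this.1.symm)
    obtain ⟨hxu, hx⟩ := Finset.mem_erase.1 hx
    obtain ⟨hyu, hy⟩ := Finset.mem_erase.1 hy
    exact key u hu x hx y hy hxu.symm hyu.symm hxy (Or.inr hc)
end

section
/- For all sufficiently large integers r, G(r, 2) ≥ r²/4; that is, with n = ⌊r²/4⌋, there exists a coloring of the edges of the grid graph Γ_{n,n} in which every row edge receives one of r colors and every column edge receives one of 2 colors, containing no alternating rectangle. -/
/-- Distinct numbers below `2 ^ k` differ at the binary digit `log2 (a ^^^ b)`, which is below `k`. -/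
theorem log2_xor_lt_and_testBit_ne {a b k : ℕ} (hab : a ≠ b) (ha : a < 2 ^ k) (hb : b < 2 ^ k) :
    (a ^^^ b).log2 < k ∧ a.testBit (a ^^^ b).log2 ≠ b.testBit (a ^^^ b).log2 := by
  have h0 : a ^^^ b ≠ 0 := by simpa [Nat.xor_eq_zero_iff] using hab
  refine ⟨(Nat.log2_lt h0).2 (Nat.xor_lt_two_pow ha hb), fun h => ?_⟩
  have := Nat.testBit_log2 h0
  rw [Nat.testBit_xor, h] at this
  simp at this

/-- A family of `m` words of length `k` over `r` letters, any two of which agree in at most one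
position, yields a coloring of the `m × n` grid without alternating rectangles, with `r` row
colors and `2` column colors, whenever `n ≤ 2 ^ k`. -/
theorem exists_coloring_of_words {m n k r : ℕ} (w : Fin m → ℕ → ℕ) (hw : ∀ i l, w i l < r)
    (huniq : ∀ i i', i ≠ i' → ∀ l < k, ∀ l' < k, w i l = w i' l → w i l' = w i' l' → l = l')
    (hn : n ≤ 2 ^ k) :
    ∃ c : Sym2 (Fin m × Fin n) → ℕ,
      (∀ x y : Fin m × Fin n, x ≠ y → x.1 = y.1 → c s(x, y) < r) ∧
      (∀ x y : Fin m × Fin n, x ≠ y → x.2 = y.2 → c s(x, y) < 2) ∧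
      ¬ HasAltRect c := by
  let f (x y : Fin m × Fin n) : ℕ :=
    if x.1 = y.1 then w x.1 (x.2.val ^^^ y.2.val).log2
    else ((min x.2 y.2).val.testBit (sInf {l | w x.1 l = w y.1 l})).toNat
  have hf (x y : Fin m × Fin n) : f x y = f y x := by
    by_cases h : x.1 = y.1
    · simp [f, h, Nat.xor_comm]
    · simp [f, h, Ne.symm h, min_comm, eq_comm]
  refine ⟨Sym2.lift ⟨f, hf⟩, fun x y _ h => ?_, fun x y hxy h => ?_, ?_⟩
  · simpa [f, h] using hw _ _
  · have h1 : x.1 ≠ y.1 := fun h1 => hxy (Prod.ext h1 h)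
    simpa [f, h1] using Nat.lt_succ_of_le (Bool.toNat_le _)
  · rintro ⟨i, i', j, j', hi, hj, hcol, hrow⟩
    obtain ⟨hl, hbit⟩ := log2_xor_lt_and_testBit_ne (Fin.val_ne_of_ne hj.ne)
      (j.isLt.trans_le hn) (j'.isLt.trans_le hn)
    simp only [Sym2.lift_mk, f, if_true, hi.ne, if_false, min_self] at hcol hrow
    have hmem : sInf {l | w i l = w i' l} ∈ {l | w i l = w i' l} := Nat.sInf_mem ⟨_, hrow⟩
    have hle : sInf {l | w i l = w i' l} ≤ (j.val ^^^ j'.val).log2 := Nat.sInf_le hrow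
    rw [huniq i i' hi.ne _ (hle.trans_lt hl) _ hl hmem hrow] at hcol
    revert hbit hcol
    cases j.val.testBit (j.val ^^^ j'.val).log2 <;>
      cases j'.val.testBit (j.val ^^^ j'.val).log2 <;> simp

/-- Lines over `ZMod p`: there are `m` words of length `p` over `p` letters, any two of which agree
in at most one position, as soon as `m ≤ p ^ 2`. -/
theorem exists_words_of_prime {p m : ℕ} (hp : p.Prime) (hm : m ≤ p ^ 2) :
    ∃ w : Fin m → ℕ → ℕ, (∀ i l, w i l < p) ∧
      ∀ i i', i ≠ i' → ∀ l < p, ∀ l' < p, w i l = w i' l → w i l' = w i' l' → l = l' := by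
  have : Fact p.Prime := ⟨hp⟩
  have cast_inj {a b : ℕ} (ha : a < p) (hb : b < p) (h : (a : ZMod p) = b) : a = b := by
    rw [← ZMod.val_cast_of_lt ha, ← ZMod.val_cast_of_lt hb, h]
  refine ⟨fun i l => (((i.val / p : ℕ) + l * (i.val % p : ℕ) : ZMod p)).val,
    fun i l => ZMod.val_lt _, fun i i' hi l hl l' hl' h h' => ?_⟩
  have h := ZMod.val_injective p h
  have h' := ZMod.val_injective p h'
  have hdiv (a : Fin m) : a.val / p < p :=
    Nat.div_lt_of_lt_mul (by have := a.isLt; rw [← sq]; omega)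
  have hmul : ((l : ZMod p) - l') * ((i.val % p : ℕ) - (i'.val % p : ℕ)) = 0 := by
    linear_combination h - h'
  rcases mul_eq_zero.1 hmul with hll | hmod
  · exact cast_inj hl hl' (sub_eq_zero.1 hll)
  · have hd : ((i.val / p : ℕ) : ZMod p) = (i'.val / p : ℕ) := by
      linear_combination h - l * hmod
    have h1 := cast_inj (Nat.mod_lt _ hp.pos) (Nat.mod_lt _ hp.pos) (sub_eq_zero.1 hmod)
    have h2 := cast_inj (hdiv i) (hdiv i') hd
    refine absurd (Fin.ext ?_) hi
    rw [← Nat.div_add_mod i.val p, ← Nat.div_add_mod i'.val p, h1, h2]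

theorem sq_le_two_pow {n : ℕ} (hn : 4 ≤ n) : n ^ 2 ≤ 2 ^ n := by
  induction n, hn using Nat.le_induction with
  | base => norm_num
  | succ n hn ih => rw [pow_succ 2]; nlinarith

/-- `G(r,2) ≥ r²/4` for all sufficiently large `r`: with `n = ⌊r²/4⌋`, there is an
edge coloring of `Γ_{n,n}` in which every row edge (same first coordinate) gets
one of `r` colors, every column edge (same second coordinate) gets one of `2`
colors, and which contains no alternating rectangle. -/
theorem asymmetric_grid_lower_bound :
    ∃ r0 : ℕ, ∀ r : ℕ, r0 ≤ r →
      ∃ c : Sym2 (Fin (r ^ 2 / 4) × Fin (r ^ 2 / 4)) → ℕ,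
        (∀ x y : Fin (r ^ 2 / 4) × Fin (r ^ 2 / 4), x ≠ y → x.1 = y.1 →
          c s(x, y) < r) ∧
        (∀ x y : Fin (r ^ 2 / 4) × Fin (r ^ 2 / 4), x ≠ y → x.2 = y.2 →
          c s(x, y) < 2) ∧
        ¬ HasAltRect c := by
  refine ⟨8, fun r hr => ?_⟩
  obtain ⟨p, hp, hlt, hle⟩ := Nat.exists_prime_lt_and_le_two_mul (r / 2) (by omega)
  have hsq : r ^ 2 / 4 ≤ p ^ 2 :=
    Nat.div_le_of_le_mul (by nlinarith [show r ≤ 2 * p by omega])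
  have hpow : p ^ 2 ≤ 2 ^ p := sq_le_two_pow (by omega)
  obtain ⟨w, hw, huniq⟩ := exists_words_of_prime hp hsq
  exact exists_coloring_of_words w (fun i l => (hw i l).trans_le (by omega)) huniq
    (hsq.trans hpow)
end
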